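/- arXiv:2408.04433 — 4 statements merged into one kernel-verified Lean document; each statement's English description precedes it below -/
import Mathlib

section
/- For all nonnegative integers m, n, let p(m,n,k) denote the number of partitions of k with at most m parts, each part at most n. Then p(m,n,k) = p(m,n,mn−k) for every integer 0 ≤ k ≤ mn, and p(m,n,k) ≤ p(m,n,k+1) for every integer k ≥ 0 with 2(k+1) ≤ mn. (Equivalently, the Gaussian polynomial [m+n choose m]_q is a symmetric unimodal polynomial in q; this is the content of Lemma 2.1 of the paper.) -/
/-- `boxCount m n k` is the number of partitions of `k` with at most `m` parts,
each part at most `n` (partitions fitting in an `m × n` box). -/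
noncomputable def boxCount (m n k : ℕ) : ℕ :=
  Nat.card {p : Nat.Partition k // Multiset.card p.parts ≤ m ∧ ∀ x ∈ p.parts, x ≤ n}

open MvPolynomial in
/-- The derivation of the polynomial ring in `n + 1` variables sending `X i` to `f i`. -/
noncomputable def dv (n : ℕ) (f : Fin (n + 1) → MvPolynomial (Fin (n + 1)) ℚ) :
    Derivation ℚ (MvPolynomial (Fin (n + 1)) ℚ) (MvPolynomial (Fin (n + 1)) ℚ) :=
  ∑ i, f i • pderiv i

open MvPolynomial in
lemma dv_apply (n : ℕ) (f : Fin (n + 1) → MvPolynomial (Fin (n + 1)) ℚ) (p) :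
    dv n f p = ∑ i, f i * pderiv i p := by
  have : ∀ t : Finset (Fin (n + 1)), (∑ i ∈ t, f i • pderiv (R := ℚ) i) p =
      ∑ i ∈ t, f i * pderiv i p := by
    intro t
    induction t using Finset.induction_on with
    | empty => simp
    | insert a t ha ih =>
      rw [Finset.sum_insert ha, Finset.sum_insert ha, Derivation.add_apply, ih]; simp
  exact this _

open MvPolynomial in
lemma dv_X (n : ℕ) (f : Fin (n + 1) → MvPolynomial (Fin (n + 1)) ℚ) (j) :
    dv n f (X j) = f j := by
  rw [dv_apply, Finset.sum_eq_single j]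
  · simp
  · intro b _ hb
    rw [pderiv_X_of_ne hb.symm, mul_zero]
  · simp

/-- bigrading weights -/
def wt (n : ℕ) (i : Fin (n + 1)) : ℤ × ℤ := (1, (i : ℤ))

open MvPolynomial in
lemma dv_hom (n : ℕ) (f : Fin (n + 1) → MvPolynomial (Fin (n + 1)) ℚ) (δ a : ℤ × ℤ)
    (hf : ∀ i, (f i).IsWeightedHomogeneous (wt n) (wt n i + δ))
    (p : MvPolynomial (Fin (n + 1)) ℚ) (hp : p.IsWeightedHomogeneous (wt n) a) :
    (dv n f p).IsWeightedHomogeneous (wt n) (a + δ) := by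
  rw [dv_apply]
  apply IsWeightedHomogeneous.sum
  intro i _
  have h1 : (pderiv i p).IsWeightedHomogeneous (wt n) (a - wt n i) :=
    hp.pderiv (by abel)
  have := (hf i).mul h1
  convert! this using 1
  abel

open MvPolynomial in
/-- raising images -/
noncomputable def fE (n : ℕ) (i : Fin (n + 1)) : MvPolynomial (Fin (n + 1)) ℚ :=
  if h : (i : ℕ) < n then C ((n : ℚ) - i) * X ⟨i + 1, by omega⟩ else 0

open MvPolynomial in
/-- lowering images -/
noncomputable def fF (n : ℕ) (i : Fin (n + 1)) : MvPolynomial (Fin (n + 1)) ℚ :=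
  if 0 < (i : ℕ) then C (i : ℚ) * X ⟨i - 1, by omega⟩ else 0

open MvPolynomial in
/-- weight operator images -/
noncomputable def fH (n : ℕ) (i : Fin (n + 1)) : MvPolynomial (Fin (n + 1)) ℚ :=
  C ((n : ℚ) - 2 * i) * X i

open MvPolynomial in
lemma fE_hom (n : ℕ) (i) : (fE n i).IsWeightedHomogeneous (wt n) (wt n i + (0, 1)) := by
  unfold fE
  split_ifs with h
  · have := (isWeightedHomogeneous_X ℚ (wt n) (⟨i + 1, by omega⟩ : Fin (n + 1))).C_mul
      ((n : ℚ) - i)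
    convert! this using 1
  · exact isWeightedHomogeneous_zero _ _ _

open MvPolynomial in
lemma fF_hom (n : ℕ) (i) : (fF n i).IsWeightedHomogeneous (wt n) (wt n i + (0, -1)) := by
  unfold fF
  split_ifs with h
  · have := (isWeightedHomogeneous_X ℚ (wt n) (⟨i - 1, by omega⟩ : Fin (n + 1))).C_mul
      (i : ℚ)
    convert! this using 1
    ext <;> simp [wt]
    omega
  · exact isWeightedHomogeneous_zero _ _ _

open MvPolynomial in
lemma bracket_eq (n : ℕ) : ⁅dv n (fF n), dv n (fE n)⁆ = dv n (fH n) := by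
  apply derivation_ext
  intro i
  rw [Derivation.commutator_apply, dv_X, dv_X, dv_X]
  obtain ⟨i, hi⟩ := i
  have h1 : dv n (fF n) (fE n ⟨i, hi⟩) = C (((n : ℚ) - i) * (i + 1)) * X ⟨i, hi⟩ := by
    unfold fE
    split_ifs with h
    · rw [← smul_eq_C_mul, Derivation.map_smul, dv_X]
      simp [fF, smul_eq_C_mul, mul_assoc]
    · have : n = i := by simp at h; omega
      subst this; simp
  have h2 : dv n (fE n) (fF n ⟨i, hi⟩) = C ((i : ℚ) * (n - i + 1)) * X ⟨i, hi⟩ := by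
    unfold fF
    split_ifs with h
    · rw [← smul_eq_C_mul, Derivation.map_smul, dv_X]
      simp only at h
      obtain ⟨j, rfl⟩ : ∃ j, i = j + 1 := ⟨i - 1, by omega⟩
      have : j < n := by omega
      simp [fE, smul_eq_C_mul, mul_assoc, this]
      left; ring
    · have : i = 0 := by simp at h; omega
      subst this; simp
  rw [h1, h2, fH, ← sub_mul, ← C_sub]
  congr 2
  ring

open MvPolynomial in
lemma H_apply (n : ℕ) (a b : ℤ) (p : MvPolynomial (Fin (n + 1)) ℚ)
    (hp : p.IsWeightedHomogeneous (wt n) (a, b)) :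
    dv n (fH n) p = ((n : ℚ) * a - 2 * b) • p := by
  have key : ∀ d : Fin (n + 1) →₀ ℕ, Finsupp.weight (wt n) d = (a, b) → ∀ r : ℚ,
      dv n (fH n) (monomial d r) = ((n : ℚ) * a - 2 * b) • monomial d r := by
    intro d hd r
    rw [dv_apply]
    simp only [fH, mul_assoc, X_mul_pderiv_monomial]
    rw [Finsupp.weight_eq_sum] at hd
    have ha : ∑ i, (d i : ℚ) = a := by
      have := congrArg Prod.fst hd
      simp [Prod.fst_sum, wt] at this
      rw [← this]; push_cast; rfl
    have hb : ∑ i : Fin (n + 1), (d i : ℚ) * (i : ℕ) = b := by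
      have := congrArg Prod.snd hd
      simp [Prod.snd_sum, wt] at this
      rw [← this]; push_cast; rfl
    rw [← ha, ← hb, Finset.mul_sum, Finset.mul_sum, ← Finset.sum_sub_distrib, Finset.sum_smul]
    apply Finset.sum_congr rfl
    intro i _
    rw [← smul_eq_C_mul, ← Nat.cast_smul_eq_nsmul ℚ, smul_smul]
    congr 1
    ring
  rw [p.as_sum, map_sum, Finset.smul_sum]
  apply Finset.sum_congr rfl
  intro d hd
  exact key d (hp (mem_support_iff.mp hd)) _

open MvPolynomial in
lemma E_inj (n : ℕ) (m k : ℤ) (hk : 2 * k < m * n) (x : MvPolynomial (Fin (n + 1)) ℚ)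
    (hx : x.IsWeightedHomogeneous (wt n) (m, k)) (hE : dv n (fE n) x = 0) : x = 0 := by
  set E := dv n (fE n) with hEdef
  set F := dv n (fF n) with hFdef
  have hF : ∀ j : ℕ, (F^[j] x).IsWeightedHomogeneous (wt n) (m, k - j) := by
    intro j
    induction j with
    | zero => simpa using hx
    | succ j ih =>
      rw [Function.iterate_succ_apply']
      have := dv_hom n (fF n) (0, -1) _ (fF_hom n) _ ih
      convert! this using 1
      ext <;> simp
      ring
  have hcomm : ∀ j : ℕ, F (E (F^[j] x)) - E (F (F^[j] x)) =
      ((n : ℚ) * m - 2 * (k - j)) • F^[j] x := by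
    intro j
    rw [← Derivation.commutator_apply, bracket_eq, H_apply n _ _ _ (hF j)]
    push_cast
    rfl
  have hpos : (2 : ℚ) * k < m * n := by exact_mod_cast hk
  have hstep : ∀ j : ℕ, ∃ c : ℚ, 0 < c ∧ E (F^[j + 1] x) = (-c) • F^[j] x := by
    intro j
    induction j with
    | zero =>
      refine ⟨(n : ℚ) * m - 2 * k, by linarith, ?_⟩
      have := hcomm 0
      simp only [Function.iterate_zero, id, hE, map_zero] at this
      simp only [Function.iterate_succ, Function.iterate_zero, id, Function.comp]
      rw [neg_smul, eq_neg_iff_add_eq_zero, ← sub_eq_zero]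
      simp at this
      rw [← this]; simp
    | succ j ih =>
      obtain ⟨c, hc, h⟩ := ih
      refine ⟨c + ((n : ℚ) * m - 2 * (k - (j + 1 : ℕ))), ?_, ?_⟩
      · have : (0 : ℚ) ≤ (j + 1 : ℕ) := by positivity
        linarith
      · have h2 := hcomm (j + 1)
        rw [h, Derivation.map_smul, ← Function.iterate_succ_apply' F,
          ← Function.iterate_succ_apply' F] at h2
        rw [neg_add, add_smul, neg_smul (_ - _), ← h2]
        simp
  have hz : ∃ j : ℕ, F^[j] x = 0 := by
    refine ⟨k.toNat + 1, (hF _).eq_zero_of_no_monomials ?_⟩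
    intro d hd
    rw [Finsupp.weight_eq_sum] at hd
    have := congrArg Prod.snd hd
    simp [Prod.snd_sum, wt] at this
    have h0 : (0 : ℤ) ≤ ∑ i : Fin (n + 1), (d i : ℤ) * (i : ℕ) := by positivity
    omega
  obtain ⟨j, hj⟩ := hz
  induction j with
  | zero => simpa using hj
  | succ j ih =>
    apply ih
    obtain ⟨c, hc, h⟩ := hstep j
    rw [hj, map_zero] at h
    exact (smul_eq_zero.mp h.symm).resolve_left (by linarith)

lemma wt_finite (n : ℕ) (m k : ℤ) :
    {d : Fin (n + 1) →₀ ℕ | Finsupp.weight (wt n) d = (m, k)}.Finite := by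
  apply (Finsupp.finite_of_nat_weight_eq (fun _ : Fin (n + 1) => 1) (by simp) m.toNat).subset
  intro d hd
  simp only [Set.mem_ofPred_eq, Finsupp.weight_eq_sum] at hd ⊢
  have := congrArg Prod.fst hd
  simp [Prod.fst_sum, wt] at this
  simp
  have h2 : ((∑ x, d x : ℕ) : ℤ) = m := by rw [← this]; push_cast; rfl
  omega

open MvPolynomial in
lemma finrank_wt (n : ℕ) (m k : ℤ) :
    Module.Finite ℚ (weightedHomogeneousSubmodule ℚ (wt n) (m, k)) ∧
    Module.finrank ℚ (weightedHomogeneousSubmodule ℚ (wt n) (m, k)) =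
      Nat.card {d : Fin (n + 1) →₀ ℕ | Finsupp.weight (wt n) d = (m, k)} := by
  have := (wt_finite n m k).to_subtype
  rw [weightedHomogeneousSubmodule_eq_finsupp_supported]
  have b := basisRestrictSupport ℚ {d : Fin (n + 1) →₀ ℕ | Finsupp.weight (wt n) d = (m, k)}
  exact ⟨Module.Finite.of_basis b, Module.finrank_eq_nat_card_basis b⟩

open MvPolynomial in
lemma card_wt_le (n : ℕ) (m k : ℤ) (hk : 2 * k < m * n) :
    Nat.card {d : Fin (n + 1) →₀ ℕ | Finsupp.weight (wt n) d = (m, k)} ≤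
    Nat.card {d : Fin (n + 1) →₀ ℕ | Finsupp.weight (wt n) d = (m, k + 1)} := by
  obtain ⟨f1, h1⟩ := finrank_wt n m k
  obtain ⟨f2, h2⟩ := finrank_wt n m (k + 1)
  rw [← h1, ← h2]
  have hmap : ∀ x ∈ weightedHomogeneousSubmodule ℚ (wt n) (m, k),
      (dv n (fE n)).toLinearMap x ∈ weightedHomogeneousSubmodule ℚ (wt n) (m, k + 1) := by
    intro x hx
    have := dv_hom n (fE n) (0, 1) _ (fE_hom n) x hx
    simpa using this
  apply LinearMap.finrank_le_finrank_of_injective (f := (dv n (fE n)).toLinearMap.restrict hmap)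
  rw [injective_iff_map_eq_zero]
  intro x hx
  apply Subtype.ext
  exact E_inj n m k hk x.1 x.2 (congrArg Subtype.val hx)

/-- multisets of size `m` and sum `k` in `{0, …, n}` -/
abbrev BoxMS (m n k : ℕ) : Type :=
  {s : Multiset (Fin (n + 1)) // Multiset.card s = m ∧ (s.map Fin.val).sum = k}

lemma card_BoxMS (m n k : ℕ) : Nat.card (BoxMS m n k) =
    Nat.card {d : Fin (n + 1) →₀ ℕ | Finsupp.weight (wt n) d = ((m : ℤ), (k : ℤ))} := by
  apply Nat.card_congr
  refine Equiv.subtypeEquiv Multiset.toFinsupp.toEquiv ?_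
  intro s
  have : Finsupp.weight (wt n) (Multiset.toFinsupp s) =
      (((Multiset.card s : ℕ) : ℤ), (((s.map Fin.val).sum : ℕ) : ℤ)) := by
    induction s using Multiset.induction_on with
    | empty => simp; rfl
    | cons a s ih =>
      rw [← Multiset.singleton_add, map_add, map_add, ih, Multiset.toFinsupp_singleton,
        Finsupp.weight_single]
      simp [wt]
      ring
  change _ ↔ Finsupp.weight (wt n) (Multiset.toFinsupp s) = _
  rw [this, Prod.mk.injEq]
  norm_cast

lemma ms_split (s : Multiset ℕ) :
    s = s.filter (· ≠ 0) + Multiset.replicate (s.card - (s.filter (· ≠ 0)).card) 0 := by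
  have h := Multiset.filter_add_not (· ≠ 0) s
  have h2 : s.filter (fun a => ¬ a ≠ 0) =
      Multiset.replicate (s.card - (s.filter (· ≠ 0)).card) 0 := by
    rw [Multiset.eq_replicate]
    constructor
    · have := congrArg Multiset.card h
      rw [Multiset.card_add] at this
      omega
    · intro b hb
      simpa using (Multiset.mem_filter.mp hb).2
  rw [← h2, h]

lemma boxCount_eq (m n k : ℕ) : boxCount m n k = Nat.card (BoxMS m n k) := by
  symm
  apply Nat.card_congr
  refine Equiv.ofBijective (fun s => ⟨Nat.Partition.ofSums k (s.1.map Fin.val) s.2.2,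
    ?_, ?_⟩) ⟨?_, ?_⟩
  · rw [Nat.Partition.ofSums_parts]
    refine (Multiset.card_le_card (Multiset.filter_le _ _)).trans ?_
    simp [s.2.1]
  · intro x hx
    rw [Nat.Partition.ofSums_parts] at hx
    obtain ⟨i, _, rfl⟩ := Multiset.mem_map.mp (Multiset.mem_filter.mp hx).1
    omega
  · rintro ⟨s, hs⟩ ⟨t, ht⟩ h
    have h' := congrArg (fun q => q.1.parts) h
    simp only [Nat.Partition.ofSums_parts] at h'
    apply Subtype.ext
    apply Multiset.map_injective Fin.val_injective
    change s.map Fin.val = t.map Fin.val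
    rw [ms_split (s.map _), ms_split (t.map _), h', Multiset.card_map, Multiset.card_map, hs.1,
      ht.1]
  · rintro ⟨p, hp, hp'⟩
    have hmap : (p.parts.map (Fin.ofNat (n + 1))).map Fin.val = p.parts := by
      rw [Multiset.map_map]
      conv_rhs => rw [← Multiset.map_id p.parts]
      apply Multiset.map_congr rfl
      intro x hx
      have := hp' x hx
      simp [Fin.ofNat, Nat.mod_eq_of_lt (by omega : x < n + 1)]
    refine ⟨⟨p.parts.map (Fin.ofNat (n + 1)) + Multiset.replicate (m - p.parts.card) 0, ?_, ?_⟩, ?_⟩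
    · simp; omega
    · rw [Multiset.map_add, hmap, Multiset.sum_add, p.parts_sum]; simp
    · apply Subtype.ext
      apply Nat.Partition.ext
      rw [Nat.Partition.ofSums_parts]
      rw [Multiset.map_add, hmap, Multiset.filter_add, Multiset.map_replicate]
      have h1 : p.parts.filter (· ≠ 0) = p.parts := by
        rw [Multiset.filter_eq_self]
        intro a ha
        exact (p.parts_pos ha).ne'
      have h2 : (Multiset.replicate (m - p.parts.card) ((0 : Fin (n + 1)) : ℕ)).filter (· ≠ 0)
          = 0 := by
        rw [Multiset.filter_eq_nil]
        intro a ha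
        simp [Multiset.eq_of_mem_replicate ha]
      rw [h1, h2, add_zero]

lemma rev_sum (n : ℕ) (s : Multiset (Fin (n + 1))) :
    ((s.map Fin.rev).map Fin.val).sum + (s.map Fin.val).sum =
      s.card * n := by
  induction s using Multiset.induction_on with
  | empty => simp
  | cons a s ih =>
    simp only [Multiset.map_cons, Multiset.sum_cons, Multiset.card_cons, Fin.val_rev, add_mul]
    have := a.isLt
    rw [Nat.add_sub_add_right]
    change _ + ((s.map Fin.rev).map Fin.val).sum + _ = _
    omega

lemma BoxMS_symm (m n k : ℕ) (hk : k ≤ m * n) :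
    Nat.card (BoxMS m n k) = Nat.card (BoxMS m n (m * n - k)) := by
  apply Nat.card_congr
  have hinv : ∀ s : Multiset (Fin (n + 1)), (s.map Fin.rev).map Fin.rev = s := by
    intro s; simp [Multiset.map_map]
  refine Equiv.subtypeEquiv ⟨Multiset.map Fin.rev, Multiset.map Fin.rev, hinv, hinv⟩ ?_
  intro s
  have := rev_sum n s
  simp only [Equiv.coe_fn_mk, Multiset.card_map]
  constructor
  · rintro ⟨h1, h2⟩
    rw [h1, h2] at this
    exact ⟨h1, by omega⟩
  · rintro ⟨h1, h2⟩
    rw [h1, h2] at this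
    exact ⟨h1, by omega⟩

/-- Lemma 2.1 of the paper: the Gaussian polynomial `[m+n choose m]_q` is symmetric and
unimodal, i.e. `p(m,n,k) = p(m,n,mn-k)` for `0 ≤ k ≤ mn` and `p(m,n,k) ≤ p(m,n,k+1)`
whenever `2(k+1) ≤ mn`. -/
theorem gaussian_symmetric_unimodal (m n : ℕ) :
    (∀ k : ℕ, k ≤ m * n → boxCount m n k = boxCount m n (m * n - k)) ∧
    (∀ k : ℕ, 2 * (k + 1) ≤ m * n → boxCount m n k ≤ boxCount m n (k + 1)) := by
  refine ⟨fun k hk => ?_, fun k hk => ?_⟩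
  · rw [boxCount_eq, boxCount_eq]
    exact BoxMS_symm m n k hk
  · rw [boxCount_eq, boxCount_eq, card_BoxMS, card_BoxMS]
    have := card_wt_le n m k (by zify at hk; linarith)
    exact_mod_cast this
end

section
/- For all integers m, n ≥ 0, b₀(m,n) ≥ b₀(m+2,n), where b₀(m,n) is the number of plane partitions π with w(π) = n and w₋(π) − w₊(π) = m. (Theorem 2.7 of the paper.) -/
/-- A plane partition: a finitely supported array `π : ℕ × ℕ → ℕ` which is weakly
decreasing in both indices. -/
def IsPlanePartition (π : ℕ × ℕ → ℕ) : Prop :=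
  (Function.support π).Finite ∧
  (∀ i j : ℕ, π (i + 1, j) ≤ π (i, j)) ∧
  (∀ i j : ℕ, π (i, j + 1) ≤ π (i, j))

/-- `b₀(m, n)`: the number of plane partitions `π` with total size `w(π) = n` and
`w₋(π) - w₊(π) = m`, where `w₋` sums the entries strictly above the diagonal and
`w₊` those strictly below it. -/
noncomputable def b0 (m : ℤ) (n : ℕ) : ℕ :=
  Nat.card {π : ℕ × ℕ → ℕ // IsPlanePartition π ∧
    (∑ᶠ p : ℕ × ℕ, π p) = n ∧
    ((∑ᶠ p ∈ {p : ℕ × ℕ | p.1 < p.2}, π p : ℕ) : ℤ) -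
      ((∑ᶠ p ∈ {p : ℕ × ℕ | p.2 < p.1}, π p : ℕ) : ℤ) = m}

namespace PPU
open MvPolynomial

noncomputable def diagD (w : ℕ × ℕ → ℚ) : Derivation ℚ (MvPolynomial (ℕ × ℕ) ℚ) (MvPolynomial (ℕ × ℕ) ℚ) :=
  mkDerivation ℚ (fun p => w p • X p)

noncomputable def opE : Derivation ℚ (MvPolynomial (ℕ × ℕ) ℚ) (MvPolynomial (ℕ × ℕ) ℚ) :=
  mkDerivation ℚ (fun p => (p.1 : ℚ) • X (p.1 - 1, p.2 + 1))

noncomputable def opF : Derivation ℚ (MvPolynomial (ℕ × ℕ) ℚ) (MvPolynomial (ℕ × ℕ) ℚ) :=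
  mkDerivation ℚ (fun p => (p.2 : ℚ) • X (p.1 + 1, p.2 - 1))

noncomputable def opH := diagD (fun p => (p.2 : ℚ) - p.1)
noncomputable def opK := diagD (fun p => (p.1 : ℚ) + p.2 + 1)

lemma brEF (f) : opE (opF f) = opF (opE f) + opH f := by
  have : ⁅opE, opF⁆ = opH := by
    apply MvPolynomial.derivation_ext
    rintro ⟨i, j⟩
    rw [Derivation.commutator_apply]
    rcases i with _ | i <;> rcases j with _ | j <;>
      simp [opE, opF, opH, diagD, mkDerivation_X, smul_smul, ← sub_smul, ← neg_smul] <;> ring_nf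
  rw [← this, Derivation.commutator_apply]; ring

lemma brHE (f) : opH (opE f) = opE (opH f) + 2 * opE f := by
  have : ⁅opH, opE⁆ = (2 : ℚ) • opE := by
    apply MvPolynomial.derivation_ext
    rintro ⟨i, j⟩
    rw [Derivation.commutator_apply]
    rcases i with _ | i <;> rcases j with _ | j <;>
      simp [opE, opF, opH, diagD, mkDerivation_X, smul_smul, ← sub_smul, ← neg_smul] <;> ring_nf
  have h2 := congrArg (fun D => D f) this
  simp only [Derivation.commutator_apply, Derivation.smul_apply] at h2
  have h3 : (2:ℚ) • opE f = 2 * opE f := by rw [ofNat_smul_eq_nsmul, nsmul_eq_mul]; rfl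
  rw [h3] at h2
  rw [← h2]; ring

lemma brHF (f) : opH (opF f) = opF (opH f) - 2 * opF f := by
  have : ⁅opH, opF⁆ = (-2 : ℚ) • opF := by
    apply MvPolynomial.derivation_ext
    rintro ⟨i, j⟩
    rw [Derivation.commutator_apply]
    rcases i with _ | i <;> rcases j with _ | j <;>
      simp [opE, opF, opH, diagD, mkDerivation_X, smul_smul, ← sub_smul, ← neg_smul] <;> ring_nf
  have h2 := congrArg (fun D => D f) this
  simp only [Derivation.commutator_apply, Derivation.smul_apply] at h2
  have h3 : (-2:ℚ) • opF f = - (2 * opF f) := by rw [neg_smul, ofNat_smul_eq_nsmul, nsmul_eq_mul]; rfl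
  rw [h3] at h2
  rw [sub_eq_add_neg, ← h2]; ring

lemma brKE (f) : opK (opE f) = opE (opK f) := by
  have : ⁅opK, opE⁆ = 0 := by
    apply MvPolynomial.derivation_ext
    rintro ⟨i, j⟩
    rw [Derivation.commutator_apply]
    rcases i with _ | i <;> rcases j with _ | j <;>
      simp [opE, opF, opK, diagD, mkDerivation_X, smul_smul, ← sub_smul, ← neg_smul] <;> ring_nf
  have h2 := congrArg (fun D => D f) this
  simp only [Derivation.commutator_apply, Derivation.zero_apply] at h2
  exact sub_eq_zero.1 h2

lemma brKF (f) : opK (opF f) = opF (opK f) := by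
  have : ⁅opK, opF⁆ = 0 := by
    apply MvPolynomial.derivation_ext
    rintro ⟨i, j⟩
    rw [Derivation.commutator_apply]
    rcases i with _ | i <;> rcases j with _ | j <;>
      simp [opE, opF, opK, diagD, mkDerivation_X, smul_smul, ← sub_smul, ← neg_smul] <;> ring_nf
  have h2 := congrArg (fun D => D f) this
  simp only [Derivation.commutator_apply, Derivation.zero_apply] at h2
  exact sub_eq_zero.1 h2

lemma diagD_monomial (w : ℕ × ℕ → ℚ) (c : ℕ × ℕ →₀ ℕ) (r : ℚ) :
    diagD w (monomial c r) = (c.sum fun p k => (k : ℚ) * w p) • monomial c r := by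
  rw [diagD, mkDerivation_monomial, Finsupp.sum, Finsupp.sum, Finset.sum_smul, Finset.smul_sum]
  refine Finset.sum_congr rfl fun p hp => ?_
  have h1 : c - Finsupp.single p 1 + Finsupp.single p 1 = c := by
    apply tsub_add_cancel_of_le
    rw [Finsupp.single_le_iff]
    have := Finsupp.mem_support_iff.1 hp
    omega
  rw [smul_eq_mul, mul_smul_comm, X, monomial_mul, h1, smul_monomial, smul_monomial, smul_monomial]
  congr 1
  simp; ring

lemma coeff_diagD (w : ℕ × ℕ → ℚ) (c : ℕ × ℕ →₀ ℕ) (f : MvPolynomial (ℕ × ℕ) ℚ) :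
    coeff c (diagD w f) = (c.sum fun p k => (k : ℚ) * w p) * coeff c f := by
  induction f using MvPolynomial.induction_on' with
  | monomial d r =>
    rw [diagD_monomial, coeff_smul, coeff_monomial, smul_eq_mul]
    split_ifs with h
    · rw [h]
    · simp
  | add p q hp hq => rw [map_add, coeff_add, coeff_add, hp, hq, mul_add]

/-- weight set -/
def MS (m : ℤ) (n : ℕ) : Set (ℕ × ℕ →₀ ℕ) :=
  {c | (c.sum fun p k => k * (p.1 + p.2 + 1)) = n ∧
    (c.sum fun p k => (k : ℤ) * ((p.2 : ℤ) - p.1)) = m}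

lemma mem_W (m : ℤ) (n : ℕ) (f : MvPolynomial (ℕ × ℕ) ℚ) :
    f ∈ restrictSupport ℚ (MS m n) ↔ opH f = (m : ℚ) • f ∧ opK f = (n : ℚ) • f := by
  have e1 : ∀ c : ℕ × ℕ →₀ ℕ, (c.sum fun p k => (k : ℚ) * ((p.2 : ℚ) - p.1))
      = ((c.sum fun p k => (k : ℤ) * ((p.2 : ℤ) - p.1) : ℤ) : ℚ) := by
    intro c; simp [Finsupp.sum]
  have e2 : ∀ c : ℕ × ℕ →₀ ℕ, (c.sum fun p k => (k : ℚ) * ((p.1 : ℚ) + p.2 + 1))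
      = ((c.sum fun p k => k * (p.1 + p.2 + 1) : ℕ) : ℚ) := by
    intro c; simp [Finsupp.sum]
  rw [mem_restrictSupport_iff]
  constructor
  · intro h
    constructor
    all_goals
      ext c
      rw [coeff_smul, smul_eq_mul]
      by_cases hc : coeff c f = 0
      · simp [opH, opK, coeff_diagD, hc]
      · have := h (by simpa using hc : c ∈ (f.support : Set _))
        simp only [opH, opK, coeff_diagD, e1, e2]
        first | rw [this.1] | rw [this.2]
  · rintro ⟨h1, h2⟩ c hc
    have hc' : coeff c f ≠ 0 := by simpa using hc
    have a1 := congrArg (coeff c) h1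
    have a2 := congrArg (coeff c) h2
    simp only [opH, opK, coeff_diagD, e1, e2, coeff_smul, smul_eq_mul] at a1 a2
    have b1 := mul_right_cancel₀ hc' a1
    have b2 := mul_right_cancel₀ hc' a2
    exact ⟨by exact_mod_cast b2, by exact_mod_cast b1⟩

lemma MS_bound {m : ℤ} {n : ℕ} {c} (h : c ∈ MS m n) : m ≤ n := by
  obtain ⟨h1, h2⟩ := h
  rw [← h1, ← h2]
  simp only [Finsupp.sum]
  push_cast
  apply Finset.sum_le_sum
  intro p _
  apply mul_le_mul_of_nonneg_left <;> omega

lemma MS_finite (m : ℤ) (n : ℕ) : (MS m n).Finite := by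
  let B : ℕ × ℕ →₀ ℕ := Finsupp.indicator (Finset.range n ×ˢ Finset.range n) (fun _ _ => n)
  apply (Set.finite_Iic B).subset
  rintro c ⟨h1, -⟩ p
  by_cases hp : c p = 0
  · simp [hp]
  have : c p * (p.1 + p.2 + 1) ≤ n := by
    rw [← h1, Finsupp.sum]
    exact Finset.single_le_sum (f := fun p => c p * (p.1 + p.2 + 1)) (fun _ _ => Nat.zero_le _)
      (Finsupp.mem_support_iff.2 hp)
  have hc : 1 ≤ c p := by omega
  have q1 : c p ≤ n := by nlinarith
  have q2 : p.1 + p.2 + 1 ≤ n := by nlinarith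
  have hm : p ∈ Finset.range n ×ˢ Finset.range n := by
    simp only [Finset.mem_product, Finset.mem_range]; omega
  simp only [B]
  rw [Finsupp.indicator_of_mem hm]
  exact q1

lemma E_mem {m n f} (h : f ∈ restrictSupport ℚ (MS m n)) :
    opE f ∈ restrictSupport ℚ (MS (m + 2) n) := by
  rw [mem_W] at *
  constructor
  · rw [brHE, h.1, Derivation.map_smul]
    push_cast
    rw [add_smul, ofNat_smul_eq_nsmul, nsmul_eq_mul]; rfl
  · rw [brKE, h.2, Derivation.map_smul]

lemma F_mem {m n f} (h : f ∈ restrictSupport ℚ (MS (m + 2) n)) :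
    opF f ∈ restrictSupport ℚ (MS m n) := by
  rw [mem_W] at *
  constructor
  · rw [brHF, h.1, Derivation.map_smul]
    push_cast
    rw [add_smul, ofNat_smul_eq_nsmul, nsmul_eq_mul]; push_cast; ring
  · rw [brKF, h.2, Derivation.map_smul]

lemma Ek_mem {m n f} (h : f ∈ restrictSupport ℚ (MS m n)) (k : ℕ) :
    opE^[k] f ∈ restrictSupport ℚ (MS (m + 2 * k) n) := by
  induction k with
  | zero => simpa using h
  | succ k ih =>
    rw [Function.iterate_succ_apply']
    have := E_mem ih
    convert this using 2
    push_cast; ring_nf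

lemma F_Ek {m n f} (h : f ∈ restrictSupport ℚ (MS m n)) (h0 : opF f = 0) (k : ℕ) :
    opF (opE^[k+1] f) = (-((k + 1) * (m + k)) : ℚ) • opE^[k] f := by
  have key : ∀ k : ℕ, opF (opE^[k+1] f) = opE (opF (opE^[k] f)) - ((m : ℚ) + 2 * k) • opE^[k] f := by
    intro k
    have := ((mem_W _ _ _).1 (Ek_mem h k)).1
    rw [Function.iterate_succ_apply', brEF, this]
    push_cast; ring
  induction k with
  | zero => rw [key]; simp [h0]
  | succ k ih =>
    rw [key, ih, Derivation.map_smul, ← Function.iterate_succ_apply' opE, ← sub_smul]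
    congr 1
    push_cast; ring

lemma F_inj {m : ℤ} {n f} (hm : 0 < m) (h : f ∈ restrictSupport ℚ (MS m n)) (h0 : opF f = 0) :
    f = 0 := by
  have hz : ∃ k : ℕ, opE^[k] f = 0 := by
    refine ⟨n + 1, ?_⟩
    have h1 := Ek_mem h (n + 1)
    rw [mem_restrictSupport_iff] at h1
    rw [← support_eq_empty, Finset.eq_empty_iff_forall_notMem]
    intro c hc
    have := MS_bound (h1 hc)
    push_cast at this
    omega
  obtain ⟨k, hk⟩ := hz
  induction k with
  | zero => simpa using hk
  | succ k ih =>
    apply ih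
    have := F_Ek h h0 k
    rw [hk, map_zero] at this
    rcases smul_eq_zero.1 this.symm with h | h
    · exfalso
      have : (0:ℚ) < m := by exact_mod_cast hm
      have : (0:ℚ) < (k + 1) * (m + k) := by positivity
      linarith
    · exact h

lemma MS_card (m : ℤ) (hm : 0 ≤ m) (n : ℕ) : Nat.card (MS (m + 2) n) ≤ Nat.card (MS m n) := by
  have := (MS_finite m n).to_subtype
  have := (MS_finite (m+2) n).to_subtype
  have r : ∀ m, Nat.card (MS m n) = Module.finrank ℚ (restrictSupport ℚ (MS m n)) :=
    fun m => (Module.finrank_eq_nat_card_basis (basisRestrictSupport ℚ (MS m n))).symm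
  have : Module.Finite ℚ (restrictSupport ℚ (MS m n)) :=
    Module.Finite.of_basis (basisRestrictSupport ℚ (MS m n))
  rw [r, r]
  let T : restrictSupport ℚ (MS (m+2) n) →ₗ[ℚ] restrictSupport ℚ (MS m n) :=
    (opF : MvPolynomial (ℕ × ℕ) ℚ →ₗ[ℚ] MvPolynomial (ℕ × ℕ) ℚ).restrict (fun f hf => F_mem hf)
  apply LinearMap.finrank_le_finrank_of_injective (f := T)
  rw [← LinearMap.ker_eq_bot, LinearMap.ker_eq_bot']
  rintro ⟨f, hf⟩ h
  have h' : opF f = 0 := congrArg Subtype.val h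
  exact Subtype.ext (F_inj (by omega) hf h')
end PPU

namespace PPU

/-- Growth diagrams: `L a b` is the partition attached to the node `(a, b)`. -/
structure Good (L : ℕ → ℕ → ℕ → ℕ) : Prop where
  a1 : ∀ a b i, L (a + 1) b i ≤ L a b i
  a2 : ∀ a b i, L a b (i + 1) ≤ L (a + 1) b i
  b1 : ∀ a b i, L a (b + 1) i ≤ L a b i
  b2 : ∀ a b i, L a b (i + 1) ≤ L a (b + 1) i
  rl : ∀ a b i, L a b (i + 1) + L (a + 1) (b + 1) i =
    max (L (a + 1) b (i + 1)) (L a (b + 1) (i + 1)) + min (L (a + 1) b i) (L a (b + 1) i)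
  fin : ∃ N, ∀ a b i, N ≤ a ∨ N ≤ b → L a b i = 0

def toC (L : ℕ → ℕ → ℕ → ℕ) (p : ℕ × ℕ) : ℕ :=
  L p.1 p.2 0 - max (L (p.1 + 1) p.2 0) (L p.1 (p.2 + 1) 0)

def toP (L : ℕ → ℕ → ℕ → ℕ) (p : ℕ × ℕ) : ℕ :=
  L (p.1 - p.2) (p.2 - p.1) (min p.1 p.2)

lemma grid {IA IB : ℕ → ℕ → Prop} (h0 : ∀ a, IA a 0) (h1 : ∀ b, IB 0 b)
    (hs : ∀ a b, IA a b → IB a b → IA a (b + 1) ∧ IB (a + 1) b) : ∀ b a, IA a b ∧ IB a b := by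
  have key : ∀ b, (∀ a, IA a b) → ∀ a, IB a b := by
    intro b h a
    induction a with
    | zero => exact h1 b
    | succ a ih => exact (hs a b (h a) ih).2
  have hA : ∀ b a, IA a b := by
    intro b
    induction b with
    | zero => exact h0
    | succ b ih => exact fun a => (hs a b (ih a) (key b ih a)).1
  exact fun b a => ⟨hA b a, key b (hA b) a⟩

def up (π : ℕ × ℕ → ℕ) : ℕ → ℕ → ℕ → ℕ
  | 0, b, i => π (i, b + i)
  | a + 1, 0, i => π (a + 1 + i, i)
  | a + 1, b + 1, i => max (up π (a + 1) b (i + 1)) (up π a (b + 1) (i + 1)) +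
      min (up π (a + 1) b i) (up π a (b + 1) i) - up π a b (i + 1)
termination_by a b => a + b

lemma up_zero_right (π : ℕ × ℕ → ℕ) (a i) : up π a 0 i = π (a + i, i) := by
  cases a <;> simp [up]

lemma up_zero_left (π : ℕ × ℕ → ℕ) (b i) : up π 0 b i = π (i, b + i) := by
  simp [up]

lemma up_succ (π : ℕ × ℕ → ℕ) (a b i) : up π (a + 1) (b + 1) i =
    max (up π (a + 1) b (i + 1)) (up π a (b + 1) (i + 1)) +
      min (up π (a + 1) b i) (up π a (b + 1) i) - up π a b (i + 1) := by
  conv_lhs => unfold up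

lemma toP_up (π : ℕ × ℕ → ℕ) : toP (up π) = π := by
  funext ⟨i, j⟩
  rcases le_total i j with h | h
  · simp only [toP, Nat.sub_eq_zero_of_le h, up_zero_left, min_eq_left h]
    congr 2; omega
  · simp only [toP, Nat.sub_eq_zero_of_le h, up_zero_right, min_eq_right h]
    congr 2; omega

lemma good_up {π : ℕ × ℕ → ℕ} (h : IsPlanePartition π) : Good (up π) := by
  obtain ⟨hf, h1, h2⟩ := h
  have G := grid (IA := fun a b => ∀ i, up π (a + 1) b i ≤ up π a b i ∧ up π a b (i + 1) ≤ up π (a + 1) b i)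
    (IB := fun a b => ∀ i, up π a (b + 1) i ≤ up π a b i ∧ up π a b (i + 1) ≤ up π a (b + 1) i)
    (by
      intro a i
      simp only [up_zero_right]
      have e1 := h1 (a + i) i
      have e2 := h2 (a + 1 + i) i
      rw [show a + 1 + i = a + i + 1 by ring] at *
      exact ⟨e1, e2⟩)
    (by
      intro b i
      simp only [up_zero_left]
      have e1 := h2 i (b + i)
      have e2 := h1 i (b + 1 + i)
      rw [show b + 1 + i = b + i + 1 by ring] at *
      exact ⟨e1, e2⟩)
    (by
      intro a b hA hB
      constructor <;> intro i
      all_goals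
        have r := up_succ π a b i
        have := hA i
        have := hA (i + 1)
        have := hB i
        have := hB (i + 1)
        omega)
  refine ⟨fun a b i => ((G b a).1 i).1, fun a b i => ((G b a).1 i).2, fun a b i => ((G b a).2 i).1,
    fun a b i => ((G b a).2 i).2, ?_, ?_⟩
  · intro a b i
    have r := up_succ π a b i
    have := (G b a).1 i
    have := (G b a).1 (i + 1)
    have := (G b a).2 i
    have := (G b a).2 (i + 1)
    omega
  · obtain ⟨N, hN⟩ : ∃ N, ∀ i j, N ≤ i ∨ N ≤ j → π (i, j) = 0 := by
      refine ⟨hf.toFinset.sup (fun p => p.1 + p.2) + 1, fun i j h => ?_⟩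
      by_contra hne
      have : i + j ≤ hf.toFinset.sup (fun p => p.1 + p.2) :=
        Finset.le_sup (f := fun p : ℕ × ℕ => p.1 + p.2) ((hf.mem_toFinset (a := (i, j))).2 hne)
      omega
    have q1 : ∀ a b i, up π a b i ≤ up π a 0 i := by
      intro a b i
      induction b with
      | zero => exact le_rfl
      | succ b ih => exact (((G b a).2 i).1).trans ih
    have q2 : ∀ a b i, up π a b i ≤ up π 0 b i := by
      intro a b i
      induction a with
      | zero => exact le_rfl
      | succ a ih => exact (((G b a).1 i).1).trans ih
    refine ⟨N, fun a b i h => ?_⟩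
    have := q1 a b i
    have := q2 a b i
    rw [up_zero_left, up_zero_right] at *
    rcases h with h | h
    · have := hN (a + i) i (Or.inl (by omega)); omega
    · have := hN i (b + i) (Or.inr (by omega)); omega

lemma Good.le_a {L} (h : Good L) (a b i : ℕ) (k : ℕ) : L a b (i + k) ≤ L (a + k) b i := by
  induction k generalizing a with
  | zero => exact le_rfl
  | succ k ih =>
    have := h.a2 a b (i + k)
    have := ih (a + 1)
    rw [show a + (k + 1) = a + 1 + k by ring, ← add_assoc]
    omega

lemma Good.le_b {L} (h : Good L) (a b i : ℕ) (k : ℕ) : L a b (i + k) ≤ L a (b + k) i := by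
  induction k generalizing b with
  | zero => exact le_rfl
  | succ k ih =>
    have := h.b2 a b (i + k)
    have := ih (b + 1)
    rw [show b + (k + 1) = b + 1 + k by ring, ← add_assoc]
    omega

lemma Good.zero {L} (h : Good L) {N} (hN : ∀ a b i, N ≤ a ∨ N ≤ b → L a b i = 0)
    (a b i : ℕ) (hh : N ≤ a + i ∨ N ≤ b + i) : L a b i = 0 := by
  have h1 := h.le_a a b 0 i
  have h2 := h.le_b a b 0 i
  rw [zero_add] at *
  rcases hh with hh | hh
  · have := hN (a + i) b 0 (Or.inl hh); omega
  · have := hN a (b + i) 0 (Or.inr hh); omega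

lemma toP_support {L} (h : Good L) {N} (hN : ∀ a b i, N ≤ a ∨ N ≤ b → L a b i = 0) (p : ℕ × ℕ)
    (hp : toP L p ≠ 0) : p.1 < N ∧ p.2 < N := by
  by_contra hc
  apply hp
  apply h.zero hN
  omega

lemma toP_pp {L} (h : Good L) : IsPlanePartition (toP L) := by
  obtain ⟨N, hN⟩ := h.fin
  refine ⟨?_, ?_, ?_⟩
  · apply (Finset.finite_toSet (Finset.range N ×ˢ Finset.range N)).subset
    intro p hp
    have := toP_support h hN p hp
    simpa using this
  · intro i j
    simp only [toP]
    rcases lt_or_ge i j with hij | hij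
    · rw [show i + 1 - j = 0 by omega, show i - j = 0 by omega, show j - i = j - (i + 1) + 1 by omega,
        show min (i + 1) j = i + 1 by omega, show min i j = i by omega]
      exact h.b2 _ _ _
    · rw [show i + 1 - j = i - j + 1 by omega, show j - i = 0 by omega, show j - (i + 1) = 0 by omega,
        show min (i + 1) j = j by omega, show min i j = j by omega]
      exact h.a1 _ _ _
  · intro i j
    simp only [toP]
    rcases lt_or_ge j i with hij | hij
    · rw [show j + 1 - i = 0 by omega, show j - i = 0 by omega, show i - j = i - (j + 1) + 1 by omega,
        show min i (j + 1) = j + 1 by omega, show min i j = j by omega]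
      exact h.a2 _ _ _
    · rw [show j + 1 - i = j - i + 1 by omega, show i - j = 0 by omega, show i - (j + 1) = 0 by omega,
        show min i (j + 1) = i by omega, show min i j = i by omega]
      exact h.b1 _ _ _

lemma toP_inj {L L'} (h : Good L) (h' : Good L') (e : toP L = toP L') : L = L' := by
  have e1 : ∀ a i, L a 0 i = L' a 0 i := by
    intro a i
    have := congrFun e (a + i, i)
    simpa [toP] using this
  have e2 : ∀ b i, L 0 b i = L' 0 b i := by
    intro b i
    have := congrFun e (i, b + i)
    simpa [toP] using this
  have : ∀ a b i, L a b i = L' a b i := by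
    intro a
    induction a with
    | zero => exact e2
    | succ a iha =>
      intro b
      induction b with
      | zero => exact e1 _
      | succ b ihb =>
        intro i
        have r := h.rl a b i
        have r' := h'.rl a b i
        rw [ihb, ihb, iha, iha, iha] at r
        omega
  funext a b i
  exact this a b i

lemma toC_inj {L L'} (h : Good L) (h' : Good L') (e : toC L = toC L') : L = L' := by
  obtain ⟨N₁, h1⟩ := h.fin
  obtain ⟨N₂, h2⟩ := h'.fin
  have : ∀ k a b, (N₁ + N₂ - a) + (N₁ + N₂ - b) ≤ k → ∀ i, L a b i = L' a b i := by
    intro k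
    induction k with
    | zero =>
      intro a b hk i
      rw [h1 _ _ _ (by omega), h2 _ _ _ (by omega)]
    | succ k ih =>
      intro a b hk i
      by_cases hab : N₁ + N₂ ≤ a ∨ N₁ + N₂ ≤ b
      · rw [h1 _ _ _ (by omega), h2 _ _ _ (by omega)]
      have i1 := ih (a + 1) b (by omega)
      have i2 := ih a (b + 1) (by omega)
      have i3 := ih (a + 1) (b + 1) (by omega)
      cases i with
      | zero =>
        have := congrFun e (a, b)
        simp only [toC] at this
        rw [i1, i2] at this
        have := h.a1 a b 0
        have := h.b1 a b 0
        have := h'.a1 a b 0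
        have := h'.b1 a b 0
        have := i1 0
        have := i2 0
        omega
      | succ i =>
        have r := h.rl a b i
        have r' := h'.rl a b i
        rw [i1, i1, i2, i2, i3] at r
        omega
  funext a b i
  exact this _ a b le_rfl i

def down (c : ℕ × ℕ → ℕ) (N : ℕ) : ℕ → ℕ → ℕ → ℕ
  | 0, _, _ => 0
  | _ + 1, 0, _ => 0
  | a + 1, b + 1, 0 => c (N - (a + 1), N - (b + 1)) + max (down c N a (b + 1) 0) (down c N (a + 1) b 0)
  | a + 1, b + 1, i + 1 => max (down c N a (b + 1) (i + 1)) (down c N (a + 1) b (i + 1)) +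
      min (down c N a (b + 1) i) (down c N (a + 1) b i) - down c N a b i
termination_by a b => a + b

lemma down_zero_left (c N b i) : down c N 0 b i = 0 := by simp [down]
lemma down_zero_right (c N a i) : down c N a 0 i = 0 := by cases a <;> simp [down]

lemma down_succ_zero (c N a b) : down c N (a + 1) (b + 1) 0 =
    c (N - (a + 1), N - (b + 1)) + max (down c N a (b + 1) 0) (down c N (a + 1) b 0) := by
  conv_lhs => unfold down
lemma down_succ_succ (c N a b i) : down c N (a + 1) (b + 1) (i + 1) =
    max (down c N a (b + 1) (i + 1)) (down c N (a + 1) b (i + 1)) +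
      min (down c N a (b + 1) i) (down c N (a + 1) b i) - down c N a b i := by
  conv_lhs => unfold down

lemma exists_toC (c : ℕ × ℕ → ℕ) (N : ℕ) (hc : ∀ p : ℕ × ℕ, N ≤ p.1 ∨ N ≤ p.2 → c p = 0) :
    ∃ L, Good L ∧ toC L = c := by
  have G := grid
    (IA := fun a b => ∀ i, down c N a b i ≤ down c N (a + 1) b i ∧ down c N (a + 1) b (i + 1) ≤ down c N a b i)
    (IB := fun a b => ∀ i, down c N a b i ≤ down c N a (b + 1) i ∧ down c N a (b + 1) (i + 1) ≤ down c N a b i)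
    (by intro a i; simp [down_zero_right])
    (by intro b i; simp [down_zero_left])
    (by
      intro a b hA hB
      constructor <;> intro i
      all_goals
        have r := down_succ_succ c N a b i
        have := hA i
        have := hB i
        refine ⟨?_, by omega⟩
        cases i with
        | zero =>
          have r := down_succ_zero c N a b
          omega
        | succ i =>
          have r := down_succ_succ c N a b i
          have := hA i
          have := hB i
          omega)
  refine ⟨fun a b i => down c N (N - a) (N - b) i, ⟨?_, ?_, ?_, ?_, ?_, ?_⟩, ?_⟩
  · intro a b i
    by_cases h : N ≤ a
    · simp [show N - a = 0 by omega, show N - (a + 1) = 0 by omega]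
    · have := ((G (N - b) (N - (a + 1))).1 i).1
      rwa [show N - (a + 1) + 1 = N - a by omega] at this
  · intro a b i
    by_cases h : N ≤ a
    · simp [show N - a = 0 by omega, down_zero_left]
    · have := ((G (N - b) (N - (a + 1))).1 i).2
      rwa [show N - (a + 1) + 1 = N - a by omega] at this
  · intro a b i
    by_cases h : N ≤ b
    · simp [show N - b = 0 by omega, show N - (b + 1) = 0 by omega]
    · have := ((G (N - (b + 1)) (N - a)).2 i).1
      rwa [show N - (b + 1) + 1 = N - b by omega] at this
  · intro a b i
    by_cases h : N ≤ b
    · simp [show N - b = 0 by omega, down_zero_right]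
    · have := ((G (N - (b + 1)) (N - a)).2 i).2
      rwa [show N - (b + 1) + 1 = N - b by omega] at this
  · intro a b i
    by_cases h : N ≤ a
    · simp [show N - a = 0 by omega, show N - (a + 1) = 0 by omega, down_zero_left]
    by_cases h' : N ≤ b
    · simp [show N - b = 0 by omega, show N - (b + 1) = 0 by omega, down_zero_right]
    have r := down_succ_succ c N (N - (a + 1)) (N - (b + 1)) i
    have g1 := (G (N - (b + 1)) (N - (a + 1))).1 i
    have g2 := (G (N - (b + 1)) (N - (a + 1))).2 i
    rw [show N - (a + 1) + 1 = N - a by omega] at *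
    rw [show N - (b + 1) + 1 = N - b by omega] at *
    omega
  · refine ⟨N, ?_⟩
    rintro a b i (h | h)
    · simp [show N - a = 0 by omega, down_zero_left]
    · simp [show N - b = 0 by omega, down_zero_right]
  · funext ⟨a, b⟩
    simp only [toC]
    by_cases h : N ≤ a
    · simp [show N - a = 0 by omega, down_zero_left, hc (a, b) (Or.inl h)]
    by_cases h' : N ≤ b
    · simp [show N - b = 0 by omega, down_zero_right, hc (a, b) (Or.inr h')]
    have r := down_succ_zero c N (N - (a + 1)) (N - (b + 1))
    rw [show N - (a + 1) + 1 = N - a by omega, show N - (b + 1) + 1 = N - b by omega,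
      show N - (N - a) = a by omega, show N - (N - b) = b by omega] at r
    omega

lemma toC_zero {L : ℕ → ℕ → ℕ → ℕ} {N} (hN : ∀ a b i, N ≤ a ∨ N ≤ b → L a b i = 0) (p : ℕ × ℕ)
    (hp : N ≤ p.1 ∨ N ≤ p.2) : toC L p = 0 := by
  simp [toC, hN p.1 p.2 0 hp]

lemma s_rec {L} (h : Good L) {N} (hN : ∀ a b i, N ≤ a ∨ N ≤ b → L a b i = 0) (a b : ℕ) :
    (toC L (a, b) : ℤ) = (∑ i ∈ Finset.range N, (L a b i : ℤ) - ∑ i ∈ Finset.range N, (L (a + 1) b i : ℤ))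
      - (∑ i ∈ Finset.range N, (L a (b + 1) i : ℤ) - ∑ i ∈ Finset.range N, (L (a + 1) (b + 1) i : ℤ)) := by
  have ind : ∀ M : ℕ, (∑ i ∈ Finset.range M, (L a b i : ℤ) - ∑ i ∈ Finset.range M, (L (a + 1) b i : ℤ))
      - (∑ i ∈ Finset.range M, (L a (b + 1) i : ℤ) - ∑ i ∈ Finset.range M, (L (a + 1) (b + 1) i : ℤ))
      = toC L (a, b) - L a b M + max (L (a + 1) b M : ℤ) (L a (b + 1) M) := by
    intro M
    induction M with
    | zero =>
      simp only [Finset.range_zero, Finset.sum_empty, toC]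
      have := h.a1 a b 0
      have := h.b1 a b 0
      omega
    | succ M ih =>
      simp only [Finset.sum_range_succ]
      have := h.rl a b M
      omega
  rw [ind N, h.zero hN a b N (by omega), h.zero hN (a + 1) b N (by omega),
    h.zero hN a (b + 1) N (by omega)]
  simp

lemma abel (s : ℕ → ℤ) (N : ℕ) :
    ∑ b ∈ Finset.range N, (b : ℤ) * (s b - s (b + 1)) = ∑ b ∈ Finset.range N, s (b + 1) - N * s N := by
  induction N with
  | zero => simp
  | succ N ih => rw [Finset.sum_range_succ, Finset.sum_range_succ, ih]; push_cast; ring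

lemma finsum_box (f : ℕ × ℕ → ℕ) (N : ℕ) (hf : ∀ p : ℕ × ℕ, N ≤ p.1 ∨ N ≤ p.2 → f p = 0) :
    ∑ᶠ p, f p = ∑ a ∈ Finset.range N, ∑ b ∈ Finset.range N, f (a, b) := by
  rw [← Finset.sum_product', finsum_eq_sum_of_support_subset]
  intro p hp
  by_contra hc
  apply hp
  apply hf
  simp at hc
  omega

lemma stat_minus {L} (h : Good L) {N} (hN : ∀ a b i, N ≤ a ∨ N ≤ b → L a b i = 0) :
    ((∑ᶠ p ∈ {p : ℕ × ℕ | p.1 < p.2}, toP L p : ℕ) : ℤ) =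
      ∑ a ∈ Finset.range N, ∑ b ∈ Finset.range N, (toC L (a, b) : ℤ) * b := by
  have e : {p : ℕ × ℕ | p.1 < p.2} = Set.range (fun q : ℕ × ℕ => (q.2, q.1 + 1 + q.2)) := by
    ext ⟨i, j⟩
    simp only [Set.mem_ofPred_eq, Set.mem_range, Prod.mk.injEq, Prod.exists]
    constructor
    · intro h; exact ⟨j - i - 1, i, rfl, by omega⟩
    · rintro ⟨b, i, rfl, rfl⟩; omega
  rw [e, finsum_mem_range (by
    rintro ⟨a, b⟩ ⟨a', b'⟩ hh
    simp only [Prod.mk.injEq] at hh ⊢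
    omega)]
  have e2 : ∀ q : ℕ × ℕ, toP L (q.2, q.1 + 1 + q.2) = L 0 (q.1 + 1) q.2 := by
    intro q
    simp only [toP]
    congr 1 <;> first | omega | (congr 1 <;> omega)
  simp only [e2]
  rw [finsum_box _ N (by
    intro p hp
    apply h.zero hN; omega)]
  push_cast
  rw [Finset.sum_comm (f := fun a b => (toC L (a, b) : ℤ) * (b : ℤ))]
  have := abel (fun b => ∑ i ∈ Finset.range N, (L 0 b i : ℤ)) N
  have z : ∑ i ∈ Finset.range N, (L 0 N i : ℤ) = 0 :=
    Finset.sum_eq_zero fun i _ => by rw [hN _ _ _ (Or.inr le_rfl)]; rfl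
  rw [z, mul_zero, sub_zero] at this
  rw [← this]
  refine Finset.sum_congr rfl fun b _ => ?_
  rw [← Finset.sum_mul, mul_comm]
  congr 1
  have z2 : ∀ b, ∑ i ∈ Finset.range N, (L N b i : ℤ) = 0 := fun b =>
    Finset.sum_eq_zero fun i _ => by rw [hN _ _ _ (Or.inl le_rfl)]; rfl
  simp only [s_rec h hN]
  rw [Finset.sum_sub_distrib, Finset.sum_range_sub' (fun a => ∑ i ∈ Finset.range N, (L a b i : ℤ)),
    Finset.sum_range_sub' (fun a => ∑ i ∈ Finset.range N, (L a (b + 1) i : ℤ)), z2, z2]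
  ring

lemma stat_plus {L} (h : Good L) {N} (hN : ∀ a b i, N ≤ a ∨ N ≤ b → L a b i = 0) :
    ((∑ᶠ p ∈ {p : ℕ × ℕ | p.2 < p.1}, toP L p : ℕ) : ℤ) =
      ∑ a ∈ Finset.range N, ∑ b ∈ Finset.range N, (toC L (a, b) : ℤ) * a := by
  have h' : Good (fun a b i => L b a i) :=
    ⟨fun a b i => h.b1 b a i, fun a b i => h.b2 b a i, fun a b i => h.a1 b a i,
      fun a b i => h.a2 b a i, fun a b i => by
        have := h.rl b a i
        rw [this, max_comm, min_comm], ⟨N, fun a b i hh => hN _ _ _ hh.symm⟩⟩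
  have := stat_minus h' (N := N) (fun a b i hh => hN _ _ _ hh.symm)
  rw [Finset.sum_comm] at this
  have e : ∀ a b, toC (fun a b i => L b a i) (a, b) = toC L (b, a) := by
    intro a b; simp only [toC]; rw [max_comm]
  simp only [e] at this
  rw [← this]
  congr 1
  refine finsum_mem_eq_of_bijOn Prod.swap ⟨?_, ?_, ?_⟩ ?_
  · intro p hp; exact hp
  · exact Prod.swap_injective.injOn
  · intro p hp; exact ⟨p.swap, hp, by simp⟩
  · intro p _
    simp only [toP, Prod.fst_swap, Prod.snd_swap]
    rw [min_comm]

lemma stat_diag {L} (h : Good L) {N} (hN : ∀ a b i, N ≤ a ∨ N ≤ b → L a b i = 0) :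
    ((∑ᶠ p ∈ {p : ℕ × ℕ | p.1 = p.2}, toP L p : ℕ) : ℤ) =
      ∑ a ∈ Finset.range N, ∑ b ∈ Finset.range N, (toC L (a, b) : ℤ) := by
  have e : {p : ℕ × ℕ | p.1 = p.2} = Set.range (fun q : ℕ => (q, q)) := by
    ext ⟨i, j⟩
    simp [eq_comm]
  rw [e, finsum_mem_range (by
    intro a a' hh
    simp only [Prod.mk.injEq] at hh
    exact hh.1)]
  have e2 : ∀ q : ℕ, toP L (q, q) = L 0 0 q := by
    intro q
    simp [toP]
  simp only [e2]
  rw [finsum_eq_sum_of_support_subset (s := Finset.range N) _ (by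
    intro i hi
    by_contra hc
    simp at hc
    exact hi (h.zero hN _ _ _ (by omega)))]
  have z2 : ∀ b, ∑ i ∈ Finset.range N, (L N b i : ℤ) = 0 := fun b =>
    Finset.sum_eq_zero fun i _ => by rw [hN _ _ _ (Or.inl le_rfl)]; rfl
  have z3 : ∑ i ∈ Finset.range N, (L 0 N i : ℤ) = 0 :=
    Finset.sum_eq_zero fun i _ => by rw [hN _ _ _ (Or.inr le_rfl)]; rfl
  rw [Finset.sum_comm]
  have : ∀ b, ∑ a ∈ Finset.range N, (toC L (a, b) : ℤ) =
      ∑ i ∈ Finset.range N, (L 0 b i : ℤ) - ∑ i ∈ Finset.range N, (L 0 (b + 1) i : ℤ) := by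
    intro b
    simp only [s_rec h hN]
    rw [Finset.sum_sub_distrib, Finset.sum_range_sub' (fun a => ∑ i ∈ Finset.range N, (L a b i : ℤ)),
      Finset.sum_range_sub' (fun a => ∑ i ∈ Finset.range N, (L a (b + 1) i : ℤ)), z2, z2]
    ring
  simp only [this]
  rw [Finset.sum_range_sub' (fun b => ∑ i ∈ Finset.range N, (L 0 b i : ℤ)), z3]
  push_cast; ring

lemma stat_total {π : ℕ × ℕ → ℕ} (hf : (Function.support π).Finite) :
    ∑ᶠ p, π p = ∑ᶠ p ∈ {p : ℕ × ℕ | p.1 < p.2}, π p + ∑ᶠ p ∈ {p : ℕ × ℕ | p.2 < p.1}, π p +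
      ∑ᶠ p ∈ {p : ℕ × ℕ | p.1 = p.2}, π p := by
  rw [← finsum_mem_union' _ (hf.subset Set.inter_subset_right) (hf.subset Set.inter_subset_right),
    ← finsum_mem_union' _ (hf.subset Set.inter_subset_right) (hf.subset Set.inter_subset_right),
    ← finsum_mem_univ]
  · have : (Set.univ : Set (ℕ × ℕ)) = {p | p.1 < p.2} ∪ {p | p.2 < p.1} ∪ {p | p.1 = p.2} := by
      ext p
      have : (p.1 < p.2 ∨ p.2 < p.1) ∨ p.1 = p.2 := by omega
      simpa using this
    rw [this]
  · rw [Set.disjoint_left]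
    rintro p (hp | hp) hp' <;> simp only [Set.mem_ofPred_eq] at * <;> omega
  · rw [Set.disjoint_left]
    intro p hp hp'
    simp only [Set.mem_ofPred_eq] at * ; omega

def PS (m : ℤ) (n : ℕ) : Set (ℕ × ℕ → ℕ) :=
  {π | IsPlanePartition π ∧
    (∑ᶠ p : ℕ × ℕ, π p) = n ∧
    ((∑ᶠ p ∈ {p : ℕ × ℕ | p.1 < p.2}, π p : ℕ) : ℤ) -
      ((∑ᶠ p ∈ {p : ℕ × ℕ | p.2 < p.1}, π p : ℕ) : ℤ) = m}

lemma mem_iff {L} (h : Good L) (c : ℕ × ℕ →₀ ℕ) (hc : toC L = c) (m : ℤ) (n : ℕ) :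
    toP L ∈ PS m n ↔ c ∈ MS m n := by
  obtain ⟨N, hN⟩ := h.fin
  have hs : c.support ⊆ Finset.range N ×ˢ Finset.range N := by
    intro p hp
    by_contra hq
    rw [Finsupp.mem_support_iff, ← hc] at hp
    apply hp
    apply toC_zero hN
    simp at hq
    omega
  have hP : toP L ∈ PS m n ↔ ((∑ᶠ p : ℕ × ℕ, toP L p) = n ∧
    ((∑ᶠ p ∈ {p : ℕ × ℕ | p.1 < p.2}, toP L p : ℕ) : ℤ) -
      ((∑ᶠ p ∈ {p : ℕ × ℕ | p.2 < p.1}, toP L p : ℕ) : ℤ) = m) :=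
    ⟨fun x => x.2, fun x => ⟨toP_pp h, x⟩⟩
  have hM : c ∈ MS m n ↔ ((c.sum fun p k => k * (p.1 + p.2 + 1)) = n ∧
    (c.sum fun p k => (k : ℤ) * ((p.2 : ℤ) - p.1)) = m) := Iff.rfl
  rw [hP, hM]
  rw [stat_total (toP_pp h).1, Finsupp.sum_of_support_subset c hs _ (by simp),
    Finsupp.sum_of_support_subset c hs _ (by simp), Finset.sum_product, Finset.sum_product,
    ← hc]
  rw [← Nat.cast_inj (R := ℤ), ← Nat.cast_inj (R := ℤ) (n := n)]
  push_cast
  rw [stat_minus h hN, stat_plus h hN, stat_diag h hN]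
  simp only [← Finset.sum_add_distrib, ← Finset.sum_sub_distrib]
  have e1 : ∀ a b : ℕ, (toC L (a, b) : ℤ) * b + (toC L (a, b) : ℤ) * a + (toC L (a, b) : ℤ) =
    (toC L (a, b) : ℤ) * (a + b + 1) := by intros; ring
  have e2 : ∀ a b : ℕ, (toC L (a, b) : ℤ) * b - (toC L (a, b) : ℤ) * a =
    (toC L (a, b) : ℤ) * (b - a) := by intros; ring
  simp only [e1, e2]

lemma PS_card (m : ℤ) (n : ℕ) : Nat.card (PS m n) = Nat.card (MS m n) := by
  let G : Set (ℕ → ℕ → ℕ → ℕ) := {L | Good L ∧ toP L ∈ PS m n}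
  have h1 : PS m n = toP '' G := by
    ext π
    constructor
    · intro h
      exact ⟨up π, ⟨good_up h.1, by rwa [toP_up]⟩, toP_up π⟩
    · rintro ⟨L, hL, rfl⟩; exact hL.2
  have h2 : (DFunLike.coe '' MS m n : Set (ℕ × ℕ → ℕ)) = toC '' G := by
    ext c
    constructor
    · rintro ⟨c, hc, rfl⟩
      obtain ⟨L, hL, hLc⟩ := exists_toC c (c.support.sup (fun p => p.1 + p.2) + 1) (by
        intro p hp
        by_contra hne
        have : p.1 + p.2 ≤ c.support.sup (fun p => p.1 + p.2) :=
          Finset.le_sup (f := fun p : ℕ × ℕ => p.1 + p.2) (Finsupp.mem_support_iff.2 hne)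
        omega)
      exact ⟨L, ⟨hL, (mem_iff hL c hLc m n).2 hc⟩, hLc⟩
    · rintro ⟨L, ⟨hL, hp⟩, rfl⟩
      obtain ⟨N, hN⟩ := hL.fin
      have hf : (Function.support (toC L)).Finite := by
        apply (Finset.finite_toSet (Finset.range N ×ˢ Finset.range N)).subset
        intro p hp
        by_contra hq
        apply hp
        apply toC_zero hN
        simp at hq
        omega
      exact ⟨Finsupp.ofSupportFinite _ hf, (mem_iff hL _ rfl m n).1 hp, rfl⟩
  rw [h1, Nat.card_image_of_injOn (fun L hL L' hL' e => toP_inj hL.1 hL'.1 e),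
    ← Nat.card_image_of_injective (DFunLike.coe_injective (F := ℕ × ℕ →₀ ℕ)) (MS m n), h2,
    Nat.card_image_of_injOn (fun L hL L' hL' e => toC_inj hL.1 hL'.1 e)]

end PPU

/-- Theorem 2.7 of the paper: `b₀(m, n) ≥ b₀(m+2, n)` for all integers `m, n ≥ 0`. -/
theorem b0_parity_unimodal (m : ℤ) (hm : 0 ≤ m) (n : ℕ) :
    b0 (m + 2) n ≤ b0 m n := by
  have h := PPU.MS_card m hm n
  rw [← PPU.PS_card, ← PPU.PS_card] at h
  exact h
end

section
/- Let S be a set of positive integers, a ∈ {1,2}, and b ∈ ℕ ∪ {∞}. For integers n ≥ 0 and m ∈ ℤ, let r_{ab,S}(m,n) be the number of quadruples (f_yellow, f_red, f_green, f_blue) of finitely supported functions ℕ → ℕ with supports contained in S, satisfying f_red(ℓ) ≤ 2−a, f_green(ℓ) ≤ b and f_blue(ℓ) ≤ b for all ℓ (inequalities in ℕ ∪ {∞}; f_yellow unrestricted), Σ_ℓ ℓ·(f_yellow(ℓ)+f_red(ℓ)+f_green(ℓ)+f_blue(ℓ)) = n, and Σ_ℓ (f_green(ℓ) − f_blue(ℓ))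 = m. Then for all integers m, n ≥ 0 with r_{ab,S}(m,n) ≠ 0, one has r_{ab,S}(m,n) > r_{ab,S}(m+a,n). (Part of Theorem 3.4 of the paper.) -/
/-- `rColored S a b m n`: the number of four-colored partitions of `n` (colors yellow, red,
green, blue) with all parts from `S`, where yellow parts are unrestricted, each red part
appears at most `2 - a` times, each green and blue part appears at most `b` times (in `ℕ∞`),
and the number of green parts minus the number of blue parts is `m`. The quadruple of
finitely supported multiplicity functions is `(f_yellow, f_red, f_green, f_blue)`. -/
noncomputable def rColored (S : Set ℕ) (a : ℕ) (b : ℕ∞) (m : ℤ) (n : ℕ) : ℕ :=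
  Nat.card {t : (ℕ →₀ ℕ) × (ℕ →₀ ℕ) × (ℕ →₀ ℕ) × (ℕ →₀ ℕ) //
    (↑t.1.support ⊆ S) ∧ (↑t.2.1.support ⊆ S) ∧
    (↑t.2.2.1.support ⊆ S) ∧ (↑t.2.2.2.support ⊆ S) ∧
    (∀ ℓ : ℕ, t.2.1 ℓ ≤ 2 - a) ∧
    (∀ ℓ : ℕ, (t.2.2.1 ℓ : ℕ∞) ≤ b) ∧ (∀ ℓ : ℕ, (t.2.2.2 ℓ : ℕ∞) ≤ b) ∧
    (∑ᶠ ℓ : ℕ, ℓ * (t.1 ℓ + t.2.1 ℓ + t.2.2.1 ℓ + t.2.2.2 ℓ)) = n ∧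
    (∑ᶠ ℓ : ℕ, ((t.2.2.1 ℓ : ℤ) - (t.2.2.2 ℓ : ℤ))) = m}


namespace RC

/-- Symmetric, nonnegative, finitely supported, strictly decreasing in steps of `a`. -/
structure GoodF (a : ℤ) (p : ℤ → ℤ) : Prop where
  fin : (Function.support p).Finite
  nonneg : ∀ m, 0 ≤ p m
  symm : ∀ m, p (-m) = p m
  le : ∀ m, 0 ≤ m → p (m + a) ≤ p m
  lt : ∀ m, 0 ≤ m → p m ≠ 0 → p (m + a) < p m

lemma GoodF.le_mul {a : ℤ} {p : ℤ → ℤ} (h : GoodF a p) (ha : 0 < a) (m : ℤ) (hm : 0 ≤ m)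
    (k : ℕ) : p (m + a * k) ≤ p m := by
  induction k with
  | zero => simp
  | succ k ih =>
    have := h.le (m + a * k) (by positivity)
    push_cast
    rw [show m + a * ((k : ℤ) + 1) = m + a * k + a by ring]
    exact this.trans ih

lemma GoodF.abs {a : ℤ} {p : ℤ → ℤ} (h : GoodF a p) (m : ℤ) : p |m| = p m := by
  rcases abs_choice m with e | e <;> rw [e]
  exact h.symm m

lemma GoodF.le_abs {a : ℤ} {p : ℤ → ℤ} (h : GoodF a p) (ha : a = 1 ∨ a = 2) (u v : ℤ)
    (huv : |u| ≤ |v|) (hd : a ∣ v - u) : p v ≤ p u := by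
  rw [← h.abs u, ← h.abs v]
  have h0 : a ∣ |v| - |u| := by
    rcases ha with rfl | rfl
    · simp
    · simp only [Int.abs_eq_natAbs] at *; omega
  obtain ⟨c, hc⟩ := h0
  have hc0 : 0 ≤ c := by rcases ha with rfl | rfl <;> simp only [Int.abs_eq_natAbs] at * <;> omega
  obtain ⟨k, rfl⟩ := Int.eq_ofNat_of_zero_le hc0
  have := h.le_mul (by omega) |u| (abs_nonneg u) k
  rwa [← hc, add_sub_cancel] at this

lemma GoodF.lt_abs {a : ℤ} {p : ℤ → ℤ} (h : GoodF a p) (ha : a = 1 ∨ a = 2) (u v : ℤ)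
    (huv : |u| < |v|) (hd : a ∣ v - u) (hu : p u ≠ 0) : p v < p u := by
  have h1 : p (|u| + a) < p |u| := h.lt _ (abs_nonneg u) (by rwa [h.abs])
  have h2 : p v ≤ p (|u| + a) := by
    apply h.le_abs ha
    · rcases ha with rfl | rfl <;> simp only [Int.abs_eq_natAbs] at * <;> omega
    · rcases ha with rfl | rfl <;> simp only [Int.abs_eq_natAbs] at * <;> omega
  rw [h.abs] at h1
  omega

/-- convolution -/
noncomputable def conv (p q : ℤ → ℤ) (m : ℤ) : ℤ := ∑ᶠ j, p (m - j) * q j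

lemma conv_comm (p q : ℤ → ℤ) : conv p q = conv q p := by
  funext m
  unfold conv
  rw [← finsum_comp_equiv (Equiv.subLeft m)]
  apply finsum_congr
  intro j
  simp [mul_comm]

lemma fs {p q : ℤ → ℤ} (hq : (Function.support q).Finite) :
    (Function.support fun j => p j * q j).Finite :=
  hq.subset (by intro j; simp)

lemma two_conv {a : ℤ} {p q : ℤ → ℤ} (hq : GoodF a q) (m : ℤ) :
    2 * (conv p q m - conv p q (m + a)) =
      ∑ᶠ j, (p (m - j) - p (m + a + j)) * (q j - q (j + a)) := by
  have f1 : (Function.support fun j => q (j + a)).Finite :=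
    hq.fin.preimage (f := fun j => j + a) (add_left_injective a).injOn
  have e2 : conv p q (m + a) = ∑ᶠ j, p (m - j) * q (j + a) := by
    unfold conv
    rw [← finsum_comp_equiv (Equiv.addRight a)]
    apply finsum_congr
    intro j
    simp
  have e3 : conv p q (m + a) = ∑ᶠ j, p (m + a + j) * q j := by
    unfold conv
    rw [← finsum_comp_equiv (Equiv.neg ℤ)]
    apply finsum_congr
    intro j
    simp [hq.symm]
  have e4 : conv p q m = ∑ᶠ j, p (m + a + j) * q (j + a) := by
    unfold conv
    rw [← finsum_comp_equiv ((Equiv.addRight a).trans (Equiv.neg ℤ))]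
    apply finsum_congr
    intro j
    simp only [Equiv.trans_apply, Equiv.coe_addRight, Equiv.neg_apply, hq.symm]
    congr 2
    ring
  have : ∀ j, (p (m - j) - p (m + a + j)) * (q j - q (j + a)) =
      (p (m - j) * q j - p (m - j) * q (j + a)) - (p (m + a + j) * q j - p (m + a + j) * q (j + a)) := by
    intro j; ring
  simp_rw [this]
  have g1 := fs (p := fun j => p (m - j)) hq.fin
  have g2 := fs (p := fun j => p (m - j)) f1
  have g3 := fs (p := fun j => p (m + a + j)) hq.fin
  have g4 := fs (p := fun j => p (m + a + j)) f1
  rw [finsum_sub_distrib, finsum_sub_distrib g1 g2, finsum_sub_distrib g3 g4,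
    ← e2, ← e3, ← e4]
  · unfold conv; ring
  · exact (g1.union g2).subset (Function.support_sub _ _)
  · exact (g3.union g4).subset (Function.support_sub _ _)

lemma term_nonneg {a : ℤ} (ha : a = 1 ∨ a = 2) {p q : ℤ → ℤ} (hp : GoodF a p) (hq : GoodF a q)
    (m : ℤ) (hm : 0 ≤ m) (j : ℤ) :
    0 ≤ (p (m - j) - p (m + a + j)) * (q j - q (j + a)) := by
  by_cases hj : |j| ≤ |j + a|
  · apply mul_nonneg
    · have := hp.le_abs ha (m - j) (m + a + j)
        (by rcases ha with rfl | rfl <;> simp only [Int.abs_eq_natAbs] at * <;> omega) (by rcases ha with rfl | rfl <;> simp only [Int.abs_eq_natAbs] at * <;> omega)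
      omega
    · have := hq.le_abs ha j (j + a) hj (by simp)
      omega
  · apply mul_nonneg_of_nonpos_of_nonpos
    · have := hp.le_abs ha (m + a + j) (m - j)
        (by rcases ha with rfl | rfl <;> simp only [Int.abs_eq_natAbs] at * <;> omega) (by rcases ha with rfl | rfl <;> simp only [Int.abs_eq_natAbs] at * <;> omega)
      omega
    · have := hq.le_abs ha (j + a) j (by omega) (by simp)
      omega

lemma conv_lt {a : ℤ} (ha : a = 1 ∨ a = 2) {p q : ℤ → ℤ} (hp : GoodF a p) (hq : GoodF a q)
    (m : ℤ) (hm : 0 ≤ m) (j : ℤ) (hj : 0 ≤ j) (h1 : p (m - j) ≠ 0) (h2 : q j ≠ 0) :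
    conv p q (m + a) < conv p q m := by
  have h := two_conv (p := p) hq m
  have f1 : (Function.support fun j => q (j + a)).Finite :=
    hq.fin.preimage (f := fun j => j + a) (add_left_injective a).injOn
  have hs : (Function.support fun j => (p (m - j) - p (m + a + j)) * (q j - q (j + a))).Finite :=
    fs (p := fun j => p (m - j) - p (m + a + j))
      ((hq.fin.union f1).subset (Function.support_sub _ _))
  have : 0 < ∑ᶠ j, (p (m - j) - p (m + a + j)) * (q j - q (j + a)) := by
    apply finsum_pos (term_nonneg ha hp hq m hm) _ hs
    refine ⟨j, mul_pos ?_ ?_⟩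
    · have := hp.lt_abs ha (m - j) (m + a + j)
        (by rcases ha with rfl | rfl <;> simp only [Int.abs_eq_natAbs] at * <;> omega) (by rcases ha with rfl | rfl <;> omega) h1
      omega
    · have := hq.lt j hj h2
      omega
  omega

lemma GoodF.conv {a : ℤ} (ha : a = 1 ∨ a = 2) {p q : ℤ → ℤ} (hp : GoodF a p) (hq : GoodF a q) :
    GoodF a (conv p q) := by
  have ex : ∀ m, RC.conv p q m ≠ 0 → ∃ j, p (m - j) ≠ 0 ∧ q j ≠ 0 := by
    intro m h
    obtain ⟨j, hj⟩ : ∃ j, p (m - j) * q j ≠ 0 := by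
      by_contra hc
      push Not at hc
      exact h (by unfold RC.conv; simp [hc])
    exact ⟨j, left_ne_zero_of_mul hj, right_ne_zero_of_mul hj⟩
  refine ⟨?_, ?_, ?_, ?_, ?_⟩
  · apply ((hp.fin.prod hq.fin).image (fun z => z.1 + z.2)).subset
    intro m hm
    obtain ⟨j, h1, h2⟩ := ex m hm
    exact ⟨(m - j, j), ⟨h1, h2⟩, by simp⟩
  · intro m
    exact finsum_nonneg fun j => mul_nonneg (hp.nonneg _) (hq.nonneg _)
  · intro m
    unfold RC.conv
    rw [← finsum_comp_equiv (Equiv.neg ℤ)]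
    apply finsum_congr
    intro j
    simp only [Equiv.neg_apply, hq.symm]
    rw [← hp.symm]
    congr 2
    ring
  · intro m hm
    have h := two_conv (p := p) hq m
    have : 0 ≤ ∑ᶠ j, (p (m - j) - p (m + a + j)) * (q j - q (j + a)) :=
      finsum_nonneg (term_nonneg ha hp hq m hm)
    omega
  · intro m hm h
    obtain ⟨j, h1, h2⟩ := ex m h
    rcases le_or_gt 0 j with hj | hj
    · exact conv_lt ha hp hq m hm j hj h1 h2
    · rw [conv_comm]
      exact conv_lt ha hq hp m hm (m - j) (by omega) (by simpa using h2) h1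

lemma GoodF.sum {a : ℤ} {ι : Type*} (s : Finset ι) (p : ι → ℤ → ℤ) (h : ∀ i ∈ s, GoodF a (p i)) :
    GoodF a (fun m => ∑ i ∈ s, p i m) := by
  refine ⟨?_, ?_, ?_, ?_, ?_⟩
  · apply (s.finite_toSet.biUnion fun i hi => (h i hi).fin).subset
    intro m hm
    obtain ⟨i, hi, hne⟩ := Finset.exists_ne_zero_of_sum_ne_zero hm
    simp only [Set.mem_iUnion]
    exact ⟨i, hi, hne⟩
  · intro m; exact Finset.sum_nonneg fun i hi => (h i hi).nonneg m
  · intro m; exact Finset.sum_congr rfl fun i hi => (h i hi).symm m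
  · intro m hm; exact Finset.sum_le_sum fun i hi => (h i hi).le m hm
  · intro m hm hne
    obtain ⟨i, hi, hne⟩ := Finset.exists_ne_zero_of_sum_ne_zero hne
    exact Finset.sum_lt_sum (fun i hi => (h i hi).le m hm) ⟨i, hi, (h i hi).lt m hm hne⟩

/-- number of elements of weight `m` -/
noncomputable def cnt {X : Type*} (w : X → ℤ) (m : ℤ) : ℤ := (Nat.card {x // w x = m} : ℤ)

lemma cnt_congr {X Y : Type*} (e : X ≃ Y) (w : X → ℤ) (v : Y → ℤ) (h : ∀ x, v (e x) = w x) :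
    cnt w = cnt v := by
  funext m
  unfold cnt
  congr 1
  exact Nat.card_congr (e.subtypeEquiv fun x => by rw [h])

lemma cnt_prod {X Y : Type*} [Finite X] [Finite Y] (w : X → ℤ) (v : Y → ℤ) :
    cnt (fun z : X × Y => w z.1 + v z.2) = conv (cnt w) (cnt v) := by
  classical
  have := Fintype.ofFinite X
  have := Fintype.ofFinite Y
  funext m
  have e1 : cnt (fun z : X × Y => w z.1 + v z.2) m = ∑ y, cnt w (m - v y) := by
    unfold cnt
    rw [← Nat.cast_sum, ← Nat.card_sigma]
    congr 1
    exact Nat.card_congr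
      { toFun := fun z => ⟨z.1.2, z.1.1, by have := z.2; simp only at this; omega⟩
        invFun := fun z => ⟨(z.2.1, z.1), by have := z.2.2; simp only; omega⟩
        left_inv := fun z => rfl
        right_inv := fun z => rfl }
  rw [e1]
  have e2 := Finset.sum_comp (s := Finset.univ) (fun j => cnt w (m - j)) v
  rw [e2]
  unfold conv
  rw [finsum_eq_sum_of_support_subset (s := Finset.univ.image v)]
  · apply Finset.sum_congr rfl
    intro j _
    simp [cnt, Fintype.card_subtype, mul_comm]
  · intro j hj
    have h2 := right_ne_zero_of_mul hj
    unfold cnt at h2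
    have h3 : Nat.card {x // v x = j} ≠ 0 := by exact_mod_cast h2
    obtain ⟨⟨y, hy⟩⟩ := (Nat.card_ne_zero.1 h3).1
    simp only [Finset.coe_image, Finset.coe_univ, Set.image_univ]
    exact ⟨y, hy⟩

lemma cnt_sigma {ι : Type*} [Fintype ι] {X : ι → Type*} [∀ i, Finite (X i)]
    (w : ∀ i, X i → ℤ) :
    cnt (fun z : Σ i, X i => w z.1 z.2) = fun m => ∑ i, cnt (w i) m := by
  funext m
  unfold cnt
  rw [← Nat.cast_sum, ← Nat.card_sigma]
  congr 1
  exact Nat.card_congr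
    { toFun := fun z => ⟨z.1.1, z.1.2, z.2⟩
      invFun := fun z => ⟨⟨z.1, z.2.1⟩, z.2.2⟩
      left_inv := fun z => rfl
      right_inv := fun z => rfl }

/-- all size fibres are finite and good -/
def GoodS (a : ℤ) (X : Type) (s : X → ℕ) (w : X → ℤ) : Prop :=
  ∀ n, Finite {x // s x = n} ∧ GoodF a (cnt (fun x : {x // s x = n} => w x))

def fibEquiv (X Y : Type) (s : X → ℕ) (t : Y → ℕ) (n : ℕ) :
    {z : X × Y // s z.1 + t z.2 = n} ≃
      Σ k : {k // k ∈ Finset.HasAntidiagonal.antidiagonal n}, {x // s x = k.1.1} × {y // t y = k.1.2} where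
  toFun z := ⟨⟨(s z.1.1, t z.1.2), by simpa using z.2⟩, ⟨z.1.1, rfl⟩, ⟨z.1.2, rfl⟩⟩
  invFun z := ⟨(z.2.1.1, z.2.2.1), by
    have h1 := z.2.1.2
    have h2 := z.2.2.2
    have h3 := Finset.HasAntidiagonal.mem_antidiagonal.1 z.1.2
    simp only [h1, h2, h3]⟩
  left_inv z := rfl
  right_inv z := by
    rcases z with ⟨⟨⟨k, l⟩, hk⟩, ⟨x, hx⟩, ⟨y, hy⟩⟩
    simp only at hx hy
    subst hx hy
    rfl

lemma GoodS.prod {a : ℤ} (ha : a = 1 ∨ a = 2) {X Y : Type} {s : X → ℕ} {t : Y → ℕ}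
    {w : X → ℤ} {v : Y → ℤ} (hX : GoodS a X s w) (hY : GoodS a Y t v) :
    GoodS a (X × Y) (fun z => s z.1 + t z.2) (fun z => w z.1 + v z.2) := by
  intro n
  have fX : ∀ n, Finite {x // s x = n} := fun n => (hX n).1
  have fY : ∀ n, Finite {x // t x = n} := fun n => (hY n).1
  refine ⟨Finite.of_equiv _ (fibEquiv X Y s t n).symm, ?_⟩
  rw [cnt_congr (fibEquiv X Y s t n)
    (fun x : {z : X × Y // s z.1 + t z.2 = n} => w x.1.1 + v x.1.2)
    (fun z => (w z.2.1.1 + v z.2.2.1)) (fun z => rfl)]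
  rw [cnt_sigma (X := fun k : {k // k ∈ Finset.HasAntidiagonal.antidiagonal n} =>
    {x // s x = k.1.1} × {y // t y = k.1.2}) (fun k z => w z.1.1 + v z.2.1)]
  apply GoodF.sum
  intro k _
  rw [cnt_prod (fun x : {x // s x = k.1.1} => w x) (fun y : {y // t y = k.1.2} => v y)]
  exact (hX _).2.conv ha (hY _).2

lemma GoodS.equiv {a : ℤ} {X Y : Type} {s : X → ℕ} {t : Y → ℕ}
    {w : X → ℤ} {v : Y → ℤ} (hX : GoodS a X s w) (e : Y ≃ X) (h1 : ∀ y, s (e y) = t y)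
    (h2 : ∀ y, w (e y) = v y) : GoodS a Y t v := by
  intro n
  have f := (hX n).1
  let e' : {y // t y = n} ≃ {x // s x = n} := e.subtypeEquiv fun y => by rw [h1]
  refine ⟨Finite.of_equiv _ e'.symm, ?_⟩
  rw [cnt_congr e' _ (fun x => w x.1) (fun y => h2 _)]
  exact (hX n).2

lemma goodS_unique {a : ℤ} (ha : a = 1 ∨ a = 2) {X : Type} [Unique X] {s : X → ℕ} {w : X → ℤ}
    (hw : ∀ x, w x = 0) : GoodS a X s w := by
  intro n
  refine ⟨inferInstance, ?_⟩
  have z : ∀ m, m ≠ 0 → cnt (fun x : {x // s x = n} => w x) m = 0 := by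
    intro m hm
    unfold cnt
    have : IsEmpty {x : {x // s x = n} // w x = m} := ⟨fun x => hm (by rw [← x.2, hw])⟩
    simp
  refine ⟨(Set.finite_singleton 0).subset ?_, ?_, ?_, ?_, ?_⟩
  · intro m hm
    by_contra h
    exact hm (z m h)
  · intro m; unfold cnt; positivity
  · intro m
    by_cases h : m = 0
    · simp [h]
    · rw [z m h, z (-m) (by omega)]
  · intro m hm
    rw [z (m + a) (by omega)]
    unfold cnt; positivity
  · intro m hm h
    rw [z (m + a) (by omega)]
    apply lt_of_le_of_ne _ h.symm
    unfold cnt; positivity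

/-- generic criterion: involution, injection, nonsurjectivity -/
lemma goodF_of_maps {a : ℤ} {X : Type} [Finite X] (w : X → ℤ)
    (inv : X ≃ X) (hinv : ∀ x, w (inv x) = - w x)
    (f : ∀ m : ℤ, 0 ≤ m → {x // w x = m + a} → {x // w x = m})
    (hf : ∀ m hm, Function.Injective (f m hm))
    (hs : ∀ m hm, Nonempty {x // w x = m} → ¬ Function.Surjective (f m hm)) :
    GoodF a (cnt w) := by
  refine ⟨?_, ?_, ?_, ?_, ?_⟩
  · apply (Set.finite_range w).subset
    intro m hm
    have h3 : Nat.card {x // w x = m} ≠ 0 := by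
      have : cnt w m ≠ 0 := hm
      unfold cnt at this
      exact_mod_cast this
    obtain ⟨⟨y, hy⟩⟩ := (Nat.card_ne_zero.1 h3).1
    exact ⟨y, hy⟩
  · intro m; unfold cnt; positivity
  · intro m
    unfold cnt
    congr 1
    exact Nat.card_congr (inv.subtypeEquiv fun x => by rw [hinv]; omega)
  · intro m hm
    unfold cnt
    exact_mod_cast Nat.card_le_card_of_injective _ (hf m hm)
  · intro m hm h
    have h3 : Nat.card {x // w x = m} ≠ 0 := by
      unfold cnt at h
      exact_mod_cast h
    have := hs m hm (Nat.card_ne_zero.1 h3).1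
    unfold cnt
    have le := Nat.card_le_card_of_injective _ (hf m hm)
    have ne : Nat.card {x // w x = m + a} ≠ Nat.card {x // w x = m} := by
      intro e
      have := Fintype.ofFinite {x // w x = m + a}
      have := Fintype.ofFinite {x // w x = m}
      rw [Nat.card_eq_fintype_card, Nat.card_eq_fintype_card] at e
      have := (Fintype.bijective_iff_injective_and_card (f m hm)).2 ⟨hf m hm, e⟩
      exact absurd this.2 ‹_›
    exact_mod_cast lt_of_le_of_ne le ne

/-- local data at the part `i` -/
abbrev Loc (S : Set ℕ) (a : ℕ) (b : ℕ∞) (i : ℕ) : Type :=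
  {q : ℕ × ℕ × ℕ × ℕ // (i ∉ S → q = 0) ∧ q.2.1 ≤ 2 - a ∧ (q.2.2.1 : ℕ∞) ≤ b ∧ (q.2.2.2 : ℕ∞) ≤ b}

def lsize (S : Set ℕ) (a : ℕ) (b : ℕ∞) (i : ℕ) (q : Loc S a b i) : ℕ :=
  i * (q.1.1 + q.1.2.1 + q.1.2.2.1 + q.1.2.2.2)

def lwt (S : Set ℕ) (a : ℕ) (b : ℕ∞) (i : ℕ) (q : Loc S a b i) : ℤ :=
  (q.1.2.2.1 : ℤ) - (q.1.2.2.2 : ℤ)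

lemma le_cast {b : ℕ∞} {x y : ℕ} (h : x ≤ y) (hy : (y : ℕ∞) ≤ b) : (x : ℕ∞) ≤ b :=
  le_trans (Nat.cast_le.2 h) hy

lemma loc_finite (S : Set ℕ) (a : ℕ) (b : ℕ∞) (i : ℕ) (hi : 0 < i) (n : ℕ) :
    Finite {x : Loc S a b i // lsize S a b i x = n} := by
  have : Finite (Set.Iic ((n, n, n, n) : ℕ × ℕ × ℕ × ℕ)) := (Set.finite_Iic _).to_subtype
  refine Finite.of_injective
    (fun x : {x : Loc S a b i // lsize S a b i x = n} =>
      (⟨x.1.1, ?_⟩ : Set.Iic ((n, n, n, n) : ℕ × ℕ × ℕ × ℕ))) ?_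
  · have h := x.2
    unfold lsize at h
    have h2 := Nat.le_mul_of_pos_left (x.1.1.1 + x.1.1.2.1 + x.1.1.2.2.1 + x.1.1.2.2.2) hi
    rw [h] at h2
    exact ⟨by show x.1.1.1 ≤ n; omega, by show x.1.1.2.1 ≤ n; omega,
      by show x.1.1.2.2.1 ≤ n; omega, by show x.1.1.2.2.2 ≤ n; omega⟩
  · intro x y h
    apply Subtype.ext
    apply Subtype.ext
    exact congrArg (fun z => z.1) h

lemma loc_good (S : Set ℕ) (hS : ∀ s ∈ S, 0 < s) (a : ℕ) (ha : a = 1 ∨ a = 2) (b : ℕ∞) (i : ℕ) :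
    GoodS (a : ℤ) (Loc S a b i) (lsize S a b i) (lwt S a b i) := by
  have ha' : (a : ℤ) = 1 ∨ (a : ℤ) = 2 := by omega
  by_cases hi : i ∈ S
  swap
  · have : Unique (Loc S a b i) :=
      { default := ⟨0, by simp⟩
        uniq := fun x => Subtype.ext (x.2.1 hi) }
    apply goodS_unique ha'
    intro x
    have := x.2.1 hi
    simp [lwt, this]
  · intro n
    have fin := loc_finite S a b i (hS i hi) n
    refine ⟨fin, ?_⟩
    let sw : {x : Loc S a b i // lsize S a b i x = n} → {x : Loc S a b i // lsize S a b i x = n} :=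
      fun x => ⟨⟨(x.1.1.1, x.1.1.2.1, x.1.1.2.2.2, x.1.1.2.2.1),
        fun h => absurd hi h, x.1.2.2.1, x.1.2.2.2.2, x.1.2.2.2.1⟩, by
          refine Eq.trans ?_ x.2; unfold lsize; ring⟩
    let inv : {x : Loc S a b i // lsize S a b i x = n} ≃ {x : Loc S a b i // lsize S a b i x = n} :=
      ⟨sw, sw, fun x => rfl, fun x => rfl⟩
    have hinv : ∀ x, lwt S a b i (inv x).1 = - lwt S a b i x.1 := by
      intro x
      show (x.1.1.2.2.2 : ℤ) - x.1.1.2.2.1 = - ((x.1.1.2.2.1 : ℤ) - x.1.1.2.2.2)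
      ring
    rcases ha with rfl | rfl
    · refine goodF_of_maps _ inv hinv (fun m hm x =>
        ⟨⟨⟨(x.1.1.1.1, 1 - x.1.1.1.2.1, x.1.1.1.2.2.1 - (1 - x.1.1.1.2.1),
          x.1.1.1.2.2.2 + x.1.1.1.2.1), fun h => absurd hi h, ?_, ?_, ?_⟩, ?_⟩, ?_⟩) ?_ ?_
      · simp
      · exact le_cast (Nat.sub_le _ _) x.1.1.2.2.2.1
      · refine le_cast ?_ x.1.1.2.2.2.1
        have h1 := x.2
        have h2 := x.1.1.2.2.1
        simp only [lwt] at h1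
        show x.1.1.1.2.2.2 + x.1.1.1.2.1 ≤ x.1.1.1.2.2.1
        omega
      · have h1 := x.2
        have h2 := x.1.1.2.2.1
        simp only [lwt] at h1
        refine Eq.trans ?_ x.1.2
        unfold lsize
        congr 1
        show x.1.1.1.1 + (1 - x.1.1.1.2.1) + (x.1.1.1.2.2.1 - (1 - x.1.1.1.2.1)) +
          (x.1.1.1.2.2.2 + x.1.1.1.2.1) = _
        omega
      · have h1 := x.2
        have h2 := x.1.1.2.2.1
        simp only [lwt] at h1 ⊢
        omega
      · rintro m hm ⟨⟨⟨⟨y, r, g, c⟩, h⟩, hs⟩, hw⟩ ⟨⟨⟨⟨y', r', g', c'⟩, h'⟩, hs'⟩, hw'⟩ he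
        simp only [Subtype.mk.injEq, Prod.mk.injEq] at he ⊢
        simp only [lwt] at hw hw'
        have h2 := h.2.1
        have h2' := h'.2.1
        simp only at h2 h2'
        omega
      · rintro m hm ⟨⟨⟨⟨⟨y, r, g, c⟩, h⟩, hs⟩, hw⟩⟩ hsurj
        simp only [lwt] at hw
        obtain ⟨⟨⟨⟨⟨y', r', g', c'⟩, h'⟩, hs'⟩, hw'⟩, he⟩ := hsurj
          ⟨⟨⟨(y + 2 * c + r, 0, g - c, 0), fun h => absurd hi h, by simp,
            le_cast (Nat.sub_le _ _) h.2.2.1, by simp⟩, by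
              rw [← hs]
              unfold lsize
              simp only
              congr 1
              omega⟩, by simp only [lwt]; omega⟩
        simp only [Subtype.mk.injEq, Prod.mk.injEq] at he
        omega
    · refine goodF_of_maps _ inv hinv (fun m hm x =>
        ⟨⟨⟨(x.1.1.1.1, x.1.1.1.2.1, x.1.1.1.2.2.1 - 1,
          x.1.1.1.2.2.2 + 1), fun h => absurd hi h, x.1.1.2.2.1, ?_, ?_⟩, ?_⟩, ?_⟩) ?_ ?_
      · exact le_cast (Nat.sub_le _ _) x.1.1.2.2.2.1
      · refine le_cast ?_ x.1.1.2.2.2.1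
        have h1 := x.2
        simp only [lwt] at h1
        show x.1.1.1.2.2.2 + 1 ≤ x.1.1.1.2.2.1
        omega
      · have h1 := x.2
        simp only [lwt] at h1
        refine Eq.trans ?_ x.1.2
        unfold lsize
        congr 1
        show x.1.1.1.1 + x.1.1.1.2.1 + (x.1.1.1.2.2.1 - 1) + (x.1.1.1.2.2.2 + 1) = _
        omega
      · have h1 := x.2
        simp only [lwt] at h1 ⊢
        omega
      · rintro m hm ⟨⟨⟨⟨y, r, g, c⟩, h⟩, hs⟩, hw⟩ ⟨⟨⟨⟨y', r', g', c'⟩, h'⟩, hs'⟩, hw'⟩ he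
        simp only [Subtype.mk.injEq, Prod.mk.injEq] at he ⊢
        simp only [lwt] at hw hw'
        omega
      · rintro m hm ⟨⟨⟨⟨⟨y, r, g, c⟩, h⟩, hs⟩, hw⟩⟩ hsurj
        simp only [lwt] at hw
        obtain ⟨⟨⟨⟨⟨y', r', g', c'⟩, h'⟩, hs'⟩, hw'⟩, he⟩ := hsurj
          ⟨⟨⟨(y + 2 * c, r, g - c, 0), fun h => absurd hi h, h.2.1,
            le_cast (Nat.sub_le _ _) h.2.2.1, by simp⟩, by
              rw [← hs]
              unfold lsize
              simp only
              congr 1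
              omega⟩, by simp only [lwt]; omega⟩
        simp only [Subtype.mk.injEq, Prod.mk.injEq] at he
        omega

lemma pi_good (S : Set ℕ) (hS : ∀ s ∈ S, 0 < s) (a : ℕ) (ha : a = 1 ∨ a = 2) (b : ℕ∞) (N : ℕ) :
    GoodS (a : ℤ) (∀ i : Fin N, Loc S a b i) (fun x => ∑ i : Fin N, lsize S a b i (x i))
      (fun x => ∑ i : Fin N, lwt S a b i (x i)) := by
  have ha' : (a : ℤ) = 1 ∨ (a : ℤ) = 2 := by omega
  induction N with
  | zero =>
    apply goodS_unique ha'
    simp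
  | succ N ih =>
    refine ((loc_good S hS a ha b N).prod ha' ih).equiv
      (Fin.snocEquiv (fun i : Fin (N + 1) => Loc S a b i)).symm ?_ ?_
    · intro x
      rw [Fin.sum_univ_castSucc, add_comm]
      rfl
    · intro x
      rw [Fin.sum_univ_castSucc, add_comm]
      rfl

lemma rColored_eq (S : Set ℕ) (hS : ∀ s ∈ S, 0 < s) (a : ℕ) (b : ℕ∞) (m : ℤ) (n : ℕ) :
    (rColored S a b m n : ℤ) =
      cnt (fun x : {x : (∀ i : Fin (n + 1), Loc S a b i) // ∑ i : Fin (n + 1), lsize S a b i (x i) = n} =>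
        ∑ i : Fin (n + 1), lwt S a b i (x.1 i)) m := by
  unfold rColored cnt
  congr 1
  -- supports are contained in `range (n+1)`
  have key : ∀ t : (ℕ →₀ ℕ) × (ℕ →₀ ℕ) × (ℕ →₀ ℕ) × (ℕ →₀ ℕ),
      (∑ᶠ ℓ : ℕ, ℓ * (t.1 ℓ + t.2.1 ℓ + t.2.2.1 ℓ + t.2.2.2 ℓ)) = n → ∀ ℓ, n < ℓ →
        t.1 ℓ = 0 ∧ t.2.1 ℓ = 0 ∧ t.2.2.1 ℓ = 0 ∧ t.2.2.2 ℓ = 0 := by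
    intro t ht ℓ hℓ
    have hf : (Function.support fun ℓ : ℕ =>
        ℓ * (t.1 ℓ + t.2.1 ℓ + t.2.2.1 ℓ + t.2.2.2 ℓ)).Finite := by
      apply (t.1 + t.2.1 + t.2.2.1 + t.2.2.2).support.finite_toSet.subset
      intro k hk
      have := right_ne_zero_of_mul hk
      simpa using this
    have h1 := single_le_finsum ℓ hf (fun _ => Nat.zero_le _)
    rw [ht] at h1
    by_contra hc
    have h2 : 1 ≤ t.1 ℓ + t.2.1 ℓ + t.2.2.1 ℓ + t.2.2.2 ℓ := by omega
    have h3 := Nat.mul_le_mul_left ℓ h2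
    omega
  have sums : ∀ t : (ℕ →₀ ℕ) × (ℕ →₀ ℕ) × (ℕ →₀ ℕ) × (ℕ →₀ ℕ),
      (∀ ℓ, n < ℓ → t.1 ℓ = 0 ∧ t.2.1 ℓ = 0 ∧ t.2.2.1 ℓ = 0 ∧ t.2.2.2 ℓ = 0) →
      (∑ᶠ ℓ : ℕ, ℓ * (t.1 ℓ + t.2.1 ℓ + t.2.2.1 ℓ + t.2.2.2 ℓ)) =
        ∑ i : Fin (n + 1), (i : ℕ) * (t.1 i + t.2.1 i + t.2.2.1 i + t.2.2.2 i) ∧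
      (∑ᶠ ℓ : ℕ, ((t.2.2.1 ℓ : ℤ) - (t.2.2.2 ℓ : ℤ))) =
        ∑ i : Fin (n + 1), ((t.2.2.1 i : ℤ) - (t.2.2.2 i : ℤ)) := by
    intro t ht
    constructor
    · rw [finsum_eq_sum_of_support_subset (s := Finset.range (n + 1)), Finset.sum_range]
      intro k hk
      simp only [Finset.coe_range, Set.mem_Iio]
      by_contra hc
      obtain ⟨h1, h2, h3, h4⟩ := ht k (by omega)
      apply hk
      simp [h1, h2, h3, h4]
    · rw [finsum_eq_sum_of_support_subset (s := Finset.range (n + 1)), Finset.sum_range]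
      intro k hk
      simp only [Finset.coe_range, Set.mem_Iio]
      by_contra hc
      obtain ⟨h1, h2, h3, h4⟩ := ht k (by omega)
      apply hk
      simp [h3, h4]
  have nz : ∀ (f : ℕ →₀ ℕ), (↑f.support ⊆ S) → ∀ i, i ∉ S → f i = 0 := by
    intro f hf i hi
    by_contra hc
    exact hi (hf (by simpa using hc))
  refine Nat.card_eq_of_bijective (fun t => ⟨⟨fun i => ⟨(t.1.1 i, t.1.2.1 i, t.1.2.2.1 i, t.1.2.2.2 i),
    ?_, t.2.2.2.2.2.1 i, t.2.2.2.2.2.2.1 i, t.2.2.2.2.2.2.2.1 i⟩, ?_⟩, ?_⟩) ⟨?_, ?_⟩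
  · intro hi
    simp [nz _ t.2.1 i hi, nz _ t.2.2.1 i hi, nz _ t.2.2.2.1 i hi, nz _ t.2.2.2.2.1 i hi]
  · have h := t.2.2.2.2.2.2.2.2.1
    exact (sums t.1 (key t.1 h)).1.symm.trans h
  · have h := t.2.2.2.2.2.2.2.2.1
    exact (sums t.1 (key t.1 h)).2.symm.trans t.2.2.2.2.2.2.2.2.2
  · intro t u h
    have h0 := congrArg (fun x => x.1.1) h
    have hloc : ∀ i, i < n + 1 → (t.1.1 i, t.1.2.1 i, t.1.2.2.1 i, t.1.2.2.2 i) =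
        (u.1.1 i, u.1.2.1 i, u.1.2.2.1 i, u.1.2.2.2 i) := by
      intro i hi
      exact congrArg Subtype.val (congrFun h0 ⟨i, hi⟩)
    have hall : ∀ i, t.1.1 i = u.1.1 i ∧ t.1.2.1 i = u.1.2.1 i ∧ t.1.2.2.1 i = u.1.2.2.1 i ∧
        t.1.2.2.2 i = u.1.2.2.2 i := by
      intro i
      by_cases hi : i < n + 1
      · simpa using hloc i hi
      · have k1 := key t.1 t.2.2.2.2.2.2.2.2.1 i (by omega)
        have k2 := key u.1 u.2.2.2.2.2.2.2.2.1 i (by omega)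
        omega
    apply Subtype.ext
    refine Prod.ext (Finsupp.ext fun i => (hall i).1) (Prod.ext (Finsupp.ext fun i => (hall i).2.1)
      (Prod.ext (Finsupp.ext fun i => (hall i).2.2.1) (Finsupp.ext fun i => (hall i).2.2.2)))
  · rintro ⟨⟨x, hx⟩, hw⟩
    let y : ℕ → ℕ × ℕ × ℕ × ℕ := fun i => if h : i < n + 1 then (x ⟨i, h⟩).1 else 0
    have ylt : ∀ i : Fin (n + 1), y i = (x i).1 := by
      intro i
      simp only [y, dif_pos i.2]
    have yge : ∀ i, n < i → y i = 0 := by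
      intro i hi
      have : ¬ i < n + 1 := by omega
      simp only [y, dif_neg this]
    have yall : ∀ i, (i ∉ S → y i = 0) ∧ (y i).2.1 ≤ 2 - a ∧ ((y i).2.2.1 : ℕ∞) ≤ b ∧
        ((y i).2.2.2 : ℕ∞) ≤ b := by
      intro i
      by_cases hi : i < n + 1
      · have := ylt ⟨i, hi⟩
        simp only at this
        rw [this]
        exact (x ⟨i, hi⟩).2
      · rw [yge i (by omega)]
        simp
    let mk : (g : ℕ × ℕ × ℕ × ℕ → ℕ) → g 0 = 0 → (ℕ →₀ ℕ) := fun g hg =>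
      Finsupp.onFinset (Finset.range (n + 1)) (fun i => g (y i)) (by
        intro i hi
        simp only [Finset.mem_range]
        by_contra hc
        exact hi (by simp only [yge i (by omega), hg]))
    have mks : ∀ g hg, ↑(mk g hg).support ⊆ S := by
      intro g hg i hi
      by_contra hc
      have h1 : g (y i) ≠ 0 := by simpa [mk] using hi
      exact h1 (by rw [(yall i).1 hc, hg])
    let t : (ℕ →₀ ℕ) × (ℕ →₀ ℕ) × (ℕ →₀ ℕ) × (ℕ →₀ ℕ) :=
      (mk (fun q => q.1) rfl, mk (fun q => q.2.1) rfl, mk (fun q => q.2.2.1) rfl,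
        mk (fun q => q.2.2.2) rfl)
    have ht : ∀ ℓ, n < ℓ → t.1 ℓ = 0 ∧ t.2.1 ℓ = 0 ∧ t.2.2.1 ℓ = 0 ∧ t.2.2.2 ℓ = 0 := by
      intro ℓ hℓ
      have := yge ℓ hℓ
      simp [t, mk, this]
    have hs := sums t ht
    refine ⟨⟨t, mks (fun q => q.1) rfl, mks (fun q => q.2.1) rfl, mks (fun q => q.2.2.1) rfl,
      mks (fun q => q.2.2.2) rfl, fun i => (yall i).2.1,
      fun i => (yall i).2.2.1, fun i => (yall i).2.2.2, ?_, ?_⟩, ?_⟩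
    · refine hs.1.trans (Eq.trans ?_ hx)
      apply Finset.sum_congr rfl
      intro i _
      simp only [t, mk, Finsupp.onFinset_apply, ylt, lsize]
    · refine hs.2.trans (Eq.trans ?_ hw)
      apply Finset.sum_congr rfl
      intro i _
      simp only [t, mk, Finsupp.onFinset_apply, ylt, lwt]
    · apply Subtype.ext
      apply Subtype.ext
      funext i
      apply Subtype.ext
      simp only [t, mk, Finsupp.onFinset_apply, ylt]

end RC

/-- Part of Theorem 3.4 of the paper: `r_{ab,S}(m,n) > r_{ab,S}(m+a,n)` for all
integers `m, n ≥ 0` with `r_{ab,S}(m,n) ≠ 0`. -/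
theorem rColored_strictly_unimodal (S : Set ℕ) (hS : ∀ s ∈ S, 0 < s)
    (a : ℕ) (ha : a = 1 ∨ a = 2) (b : ℕ∞) (m : ℤ) (hm : 0 ≤ m) (n : ℕ)
    (hne : rColored S a b m n ≠ 0) :
    rColored S a b (m + a) n < rColored S a b m n := by
  have h := (RC.pi_good S hS a ha b (n + 1) n).2.lt m hm
  rw [← RC.rColored_eq S hS, ← RC.rColored_eq S hS] at h
  exact_mod_cast h (by exact_mod_cast hne)
end

section
/- For all integers m, n ≥ 0, X(m,n) ≥ X(m+2,n), where X(m,n) is the number of convex compositions of n with rank m. (Part of Theorem 4.2 of the paper; convex compositions are the same as unimodal sequences.) -/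
/-- A convex composition of `n` with rank `m`: a triple `(a, c, b)` where `a` is a weakly
increasing list of positive integers, `b` is a weakly decreasing list of positive integers,
`c ≥ 1` is the central part, every entry of `a` and of `b` is strictly less than `c`,
`Σ a + c + Σ b = n`, and `(length of b) - (length of a) = m`. -/
def IsConvexComposition (n : ℕ) (m : ℤ) (t : List ℕ × ℕ × List ℕ) : Prop :=
  List.Chain' (fun x y => x ≤ y) t.1 ∧
  List.Chain' (fun x y => y ≤ x) t.2.2 ∧
  1 ≤ t.2.1 ∧
  (∀ x ∈ t.1, 0 < x ∧ x < t.2.1) ∧ (∀ x ∈ t.2.2, 0 < x ∧ x < t.2.1) ∧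
  t.1.sum + t.2.1 + t.2.2.sum = n ∧
  (t.2.2.length : ℤ) - (t.1.length : ℤ) = m

/-- `X m n`: the number of convex compositions of `n` with rank `m`. -/
noncomputable def X (m : ℤ) (n : ℕ) : ℕ :=
  Nat.card {t : List ℕ × ℕ × List ℕ // IsConvexComposition n m t}

/-- Number of sub-multisets of `M` with `s` elements. -/
def subCount (M : Multiset ℕ) (s : ℤ) : ℕ :=
  ∑ B ∈ Finset.Iic M, if (Multiset.card B : ℤ) = s then 1 else 0

/-- Symmetric about `d / 2` and weakly decreasing to the right of the centre. -/
def SymDec (g : ℤ → ℕ) (d : ℤ) : Prop :=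
  (∀ s, g (d - s) = g s) ∧ ∀ s, d ≤ 2 * s → g (s + 1) ≤ g s

lemma SymDec.le {g : ℤ → ℕ} {d : ℤ} (h : SymDec g d) (s t : ℤ) (hs : d ≤ 2 * s) (hst : s ≤ t) :
    g t ≤ g s := by
  induction t, hst using Int.le_induction with
  | base => exact le_rfl
  | succ t ht ih => exact (h.2 t (by lia)).trans ih

lemma SymDec.conv {g : ℤ → ℕ} {d : ℤ} (h : SymDec g d) (k : ℕ) :
    SymDec (fun s => ∑ i ∈ Finset.range (k + 1), g (s - i)) (d + k) := by
  refine ⟨fun s => ?_, fun s hs => ?_⟩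
  · dsimp only
    rw [← Finset.sum_range_reflect]
    refine Finset.sum_congr rfl fun i hi => ?_
    have hi' : i ≤ k := by simpa [Nat.lt_succ_iff] using hi
    rw [← h.1 (s - i)]
    congr 1
    have : k + 1 - 1 - i = k - i := by lia
    rw [this]
    push_cast [hi']
    ring
  · dsimp only
    rw [Finset.sum_range_succ', Finset.sum_range_succ]
    have h1 : ∀ i : ℕ, s + 1 - ((i + 1 : ℕ) : ℤ) = s - i := by intro i; push_cast; ring
    simp only [h1]
    refine Nat.add_le_add_left ?_ _
    simp only [Nat.cast_zero, sub_zero]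
    by_cases hc : d ≤ 2 * (s - k)
    · exact h.le _ _ hc (by lia)
    · rw [← h.1 (s - k)]
      exact h.le _ _ (by lia) (by lia)

lemma subCount_rec (M : Multiset ℕ) (j : ℕ) (s : ℤ) :
    subCount M s = ∑ i ∈ Finset.range (M.count j + 1),
      subCount (M.filter (fun x => ¬ x = j)) (s - i) := by
  unfold subCount
  rw [← Finset.sum_product']
  have key : ∀ B : Multiset ℕ, Multiset.replicate (B.count j) j + B.filter (fun x => ¬ x = j) = B := by
    intro B
    rw [← Multiset.filter_eq', Multiset.filter_add_not]
  refine Finset.sum_nbij' (fun B => (B.count j, B.filter (fun x => ¬ x = j)))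
    (fun p => Multiset.replicate p.1 j + p.2) ?_ ?_ ?_ ?_ ?_
  · intro B hB
    simp only [Finset.mem_Iic, Finset.mem_product, Finset.mem_range] at hB ⊢
    exact ⟨Nat.lt_succ_of_le (Multiset.count_le_of_le _ hB), Multiset.filter_le_filter _ hB⟩
  · rintro ⟨i, B⟩ hB
    simp only [Finset.mem_Iic, Finset.mem_product, Finset.mem_range] at hB ⊢
    rw [← key M]
    refine add_le_add ?_ hB.2
    exact (Multiset.replicate_le_replicate j).2 (by lia)
  · intro B _
    exact key B
  · rintro ⟨i, B⟩ hB
    simp only [Finset.mem_Iic, Finset.mem_product, Finset.mem_range] at hB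
    have hj : ∀ x ∈ B, ¬ x = j := fun x hx =>
      (Multiset.mem_filter.1 (Multiset.mem_of_le hB.2 hx)).2
    have hj' : j ∉ B := fun hx => hj j hx rfl
    have h2 : (Multiset.replicate i j).filter (fun x => ¬ x = j) = 0 := by
      rw [Multiset.filter_eq_nil]
      intro a ha
      simpa using Multiset.eq_of_mem_replicate ha
    simp [Multiset.filter_add, h2, Multiset.filter_eq_self.2 hj, hj']
  · intro B _
    have := congrArg Multiset.card (key B)
    simp only [Multiset.card_add, Multiset.card_replicate] at this
    dsimp only
    congr 1
    apply propext
    lia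

lemma subCount_symDec (M : Multiset ℕ) : SymDec (subCount M) (Multiset.card M) := by
  induction M using Multiset.strongInductionOn with
  | ih M ih =>
    rcases M.empty_or_exists_mem with rfl | ⟨j, hj⟩
    · have h0 : ∀ s, subCount 0 s = if (0 : ℤ) = s then 1 else 0 := by
        intro s
        have : Finset.Iic (0 : Multiset ℕ) = {0} := by
          ext B; simp
        unfold subCount
        rw [this, Finset.sum_singleton]
        simp
      refine ⟨fun s => ?_, fun s hs => ?_⟩
      · simp [h0, eq_comm]
      · have : ¬ (0 : ℤ) = s + 1 := by simp at hs; lia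
        simp [h0, this]
    · have hlt : M.filter (fun x => ¬ x = j) < M := by
        refine lt_of_le_of_ne (Multiset.filter_le _ _) fun h => ?_
        rw [← h] at hj
        exact (Multiset.mem_filter.1 hj).2 rfl
      have h := (ih _ hlt).conv (M.count j)
      have e1 : subCount M = _ := funext (subCount_rec M j)
      have e2 : (Multiset.card M : ℤ)
          = (Multiset.card (M.filter (fun x => ¬ x = j)) : ℤ) + (M.count j : ℕ) := by
        conv_lhs => rw [← Multiset.filter_add_not (fun x => x = j) M]
        rw [Multiset.card_add, Multiset.filter_eq', Multiset.card_replicate]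
        push_cast; ring
      rw [e1, e2]
      exact h

lemma exists_lowering (M : Multiset ℕ) (s : ℕ) (hs : Multiset.card M ≤ 2 * s) :
    ∃ f : Multiset ℕ → Multiset ℕ,
      (∀ B, B ≤ M → Multiset.card B = s + 1 → f B ≤ M ∧ Multiset.card (f B) = s) ∧
      (∀ B B', B ≤ M → Multiset.card B = s + 1 → B' ≤ M → Multiset.card B' = s + 1 →
        f B = f B' → B = B') := by
  have h := (subCount_symDec M).2 s (by exact_mod_cast hs)
  have hc : ∀ u : ℕ, subCount M u = ((Finset.Iic M).filter (fun B => Multiset.card B = u)).card := by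
    intro u
    rw [Finset.card_filter]
    simp [subCount]
  have h' : subCount M ((s + 1 : ℕ) : ℤ) ≤ subCount M (s : ℤ) := by simpa using h
  rw [hc, hc] at h'
  obtain ⟨e⟩ := Function.Embedding.nonempty_of_card_le
    (α := {B // B ∈ (Finset.Iic M).filter (fun B => Multiset.card B = s + 1)})
    (β := {B // B ∈ (Finset.Iic M).filter (fun B => Multiset.card B = s)})
    (by simpa only [Fintype.card_coe] using h')
  have hm : ∀ B, B ≤ M → Multiset.card B = s + 1 →
      B ∈ (Finset.Iic M).filter (fun B => Multiset.card B = s + 1) := by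
    intro B h1 h2; simp [h1, h2]
  classical
  refine ⟨fun B => if hB : B ∈ (Finset.Iic M).filter (fun B => Multiset.card B = s + 1)
    then (e ⟨B, hB⟩).1 else 0, ?_, ?_⟩
  · intro B h1 h2
    have := (e ⟨B, hm B h1 h2⟩).2
    dsimp only
    rw [dif_pos (hm B h1 h2)]
    simpa only [Finset.mem_filter, Finset.mem_Iic] using this
  · intro B B' h1 h2 h3 h4 he
    dsimp only at he
    rw [dif_pos (hm B h1 h2), dif_pos (hm B' h3 h4)] at he
    exact congrArg Subtype.val (e.injective (Subtype.ext he))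

lemma triple_ext {n : ℕ} {m : ℤ} {t t' : List ℕ × ℕ × List ℕ} (h : IsConvexComposition n m t)
    (h' : IsConvexComposition n m t') (ha : (t.1 : Multiset ℕ) = t'.1) (hc : t.2.1 = t'.2.1)
    (hb : (t.2.2 : Multiset ℕ) = t'.2.2) : t = t' := by
  have p1 := List.isChain_iff_pairwise.1 h.1
  have p2 := List.isChain_iff_pairwise.1 h'.1
  have q1 := (List.isChain_iff_pairwise (R := fun x y : ℕ => x ≥ y)).1 h.2.1
  have q2 := (List.isChain_iff_pairwise (R := fun x y : ℕ => x ≥ y)).1 h'.2.1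
  refine Prod.ext ?_ (Prod.ext hc ?_)
  · exact List.Perm.eq_of_pairwise (fun a b _ _ h1 h2 => le_antisymm h1 h2) p1 p2
      (Multiset.coe_eq_coe.1 ha)
  · exact List.Perm.eq_of_pairwise (fun a b _ _ h1 h2 => le_antisymm h2 h1) q1 q2
      (Multiset.coe_eq_coe.1 hb)

lemma le_big (n : ℕ) (l : List ℕ) (h0 : ∀ x ∈ l, 0 < x) (hs : l.sum ≤ n) :
    (l : Multiset ℕ) ≤ n • (Multiset.range (n + 1)) := by
  rw [Multiset.le_iff_count]
  intro x
  by_cases hx : x ∈ l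
  · have h1 : x ≤ n := (List.le_sum_of_mem hx).trans hs
    have h2 : l.length ≤ l.sum := List.length_le_sum_of_one_le l h0
    have h3 : l.count x ≤ l.length := List.count_le_length
    have h4 : Multiset.count x (Multiset.range (n + 1)) = 1 :=
      Multiset.count_eq_one_of_mem (Multiset.nodup_range _) (by simp; lia)
    rw [Multiset.count_nsmul, h4, Multiset.coe_count]
    lia
  · rw [Multiset.coe_count, List.count_eq_zero_of_not_mem hx]
    exact Nat.zero_le _

lemma finite_comps (n : ℕ) (m : ℤ) :
    Finite {t : List ℕ × ℕ × List ℕ // IsConvexComposition n m t} := by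
  have hf : Finite (Set.Iic (n • Multiset.range (n + 1)) : Set (Multiset ℕ)) :=
    (Set.finite_Iic _)
  refine Finite.of_injective
    (β := (Set.Iic (n • Multiset.range (n + 1)) : Set (Multiset ℕ)) × Fin (n + 1) ×
      (Set.Iic (n • Multiset.range (n + 1)) : Set (Multiset ℕ)))
    (fun t => (⟨(t.1.1 : Multiset ℕ), ?_⟩, ⟨t.1.2.1, ?_⟩, ⟨(t.1.2.2 : Multiset ℕ), ?_⟩)) ?_
  · obtain ⟨-, -, -, h4, h5, h6, -⟩ := t.2
    exact le_big n _ (fun x hx => (h4 x hx).1) (by lia)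
  · obtain ⟨-, -, -, h4, h5, h6, -⟩ := t.2
    lia
  · obtain ⟨-, -, -, h4, h5, h6, -⟩ := t.2
    exact le_big n _ (fun x hx => (h5 x hx).1) (by lia)
  · rintro ⟨t, ht⟩ ⟨t', ht'⟩ h
    simp only [Prod.mk.injEq, Subtype.mk.injEq, Fin.mk.injEq] at h
    exact Subtype.ext (triple_ext ht ht' h.1 h.2.1 h.2.2)

/-- Rebuild a triple from a multiset, a central part and a sub-multiset. -/
def rebuild (M : Multiset ℕ) (c : ℕ) (B : Multiset ℕ) : List ℕ × ℕ × List ℕ :=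
  ((M - B).sort (fun x y => x ≤ y), c, B.sort (fun x y => x ≥ y))

lemma rebuild_spec {n : ℕ} {m : ℤ} {t : List ℕ × ℕ × List ℕ}
    (ht : IsConvexComposition n (m + 2) t) (M B : Multiset ℕ) (hM : M = (t.1 : Multiset ℕ) + (t.2.2 : Multiset ℕ))
    (hB : B ≤ M) (hcard : Multiset.card B + 1 = t.2.2.length) :
    IsConvexComposition n m (rebuild M t.2.1 B) := by
  obtain ⟨-, -, h3, h4, h5, h6, h7⟩ := ht
  have hmem : ∀ x ∈ M, 0 < x ∧ x < t.2.1 := by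
    intro x hx
    rw [hM, Multiset.mem_add] at hx
    rcases hx with hx | hx
    · exact h4 x hx
    · exact h5 x hx
  have hsub : M - B + B = M := tsub_add_cancel_of_le hB
  have s1 := congrArg Multiset.sum hsub
  have c1 := congrArg Multiset.card hsub
  have s2 : M.sum = t.1.sum + t.2.2.sum := by simp [hM]
  have c2 : Multiset.card M = t.1.length + t.2.2.length := by simp [hM]
  rw [Multiset.sum_add] at s1
  rw [Multiset.card_add] at c1
  refine ⟨?_, ?_, h3, ?_, ?_, ?_, ?_⟩
  · exact (Multiset.pairwise_sort _ _).isChain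
  · exact (Multiset.pairwise_sort B (fun x y => x ≥ y)).isChain
  · intro x hx
    exact hmem x (Multiset.mem_of_le tsub_le_self (by simpa [rebuild] using hx))
  · intro x hx
    exact hmem x (Multiset.mem_of_le hB (by simpa [rebuild] using hx))
  · have e1 : ((M - B).sort (fun x y => x ≤ y)).sum = (M - B).sum := by
      rw [← Multiset.sum_coe, Multiset.sort_eq]
    have e2 : (B.sort (fun x y => x ≥ y)).sum = B.sum := by
      rw [← Multiset.sum_coe, Multiset.sort_eq]
    simp only [rebuild, e1, e2]
    lia
  · simp only [rebuild, Multiset.length_sort]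
    lia

/-- Part of Theorem 4.2 of the paper: `X(m,n) ≥ X(m+2,n)` for all integers `m, n ≥ 0`. -/
theorem convex_rank_parity_unimodal (m : ℤ) (hm : 0 ≤ m) (n : ℕ) :
    X (m + 2) n ≤ X m n := by
  choose! F hF1 hF2 using exists_lowering
  have := finite_comps n m
  have facts : ∀ t : List ℕ × ℕ × List ℕ, IsConvexComposition n (m + 2) t →
      Multiset.card ((t.1 : Multiset ℕ) + (t.2.2 : Multiset ℕ)) ≤ 2 * (t.2.2.length - 1) ∧
      (t.2.2 : Multiset ℕ) ≤ (t.1 : Multiset ℕ) + (t.2.2 : Multiset ℕ) ∧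
      Multiset.card (t.2.2 : Multiset ℕ) = (t.2.2.length - 1) + 1 := by
    intro t ht
    obtain ⟨-, -, -, -, -, -, h7⟩ := ht
    refine ⟨?_, Multiset.le_add_left _ _, ?_⟩
    · simp only [Multiset.card_add, Multiset.coe_card]
      lia
    · simp only [Multiset.coe_card]
      lia
  have spec : ∀ t : List ℕ × ℕ × List ℕ, IsConvexComposition n (m + 2) t →
      F ((t.1 : Multiset ℕ) + (t.2.2 : Multiset ℕ)) (t.2.2.length - 1) t.2.2 ≤ (t.1 : Multiset ℕ) + (t.2.2 : Multiset ℕ) ∧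
      Multiset.card (F ((t.1 : Multiset ℕ) + (t.2.2 : Multiset ℕ)) (t.2.2.length - 1) t.2.2)
        = t.2.2.length - 1 := by
    intro t ht
    obtain ⟨f1, f2, f3⟩ := facts t ht
    exact hF1 _ _ f1 _ f2 f3
  refine Nat.card_le_card_of_injective (fun t : {t : List ℕ × ℕ × List ℕ // IsConvexComposition n (m + 2) t} =>
    ⟨rebuild ((t.1.1 : Multiset ℕ) + (t.1.2.2 : Multiset ℕ)) t.1.2.1
    (F ((t.1.1 : Multiset ℕ) + (t.1.2.2 : Multiset ℕ)) (t.1.2.2.length - 1) t.1.2.2), ?_⟩) ?_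
  · obtain ⟨f1, f2, f3⟩ := facts t.1 t.2
    obtain ⟨g1, g2⟩ := spec t.1 t.2
    refine rebuild_spec t.2 _ _ rfl g1 ?_
    rw [g2, ← f3, Multiset.coe_card]
  · rintro ⟨t, ht⟩ ⟨t', ht'⟩ h
    obtain ⟨f1, f2, f3⟩ := facts t ht
    obtain ⟨g1, g2⟩ := spec t ht
    obtain ⟨f1', f2', f3'⟩ := facts t' ht'
    obtain ⟨g1', g2'⟩ := spec t' ht'
    simp only [Subtype.mk.injEq, rebuild, Prod.mk.injEq] at h
    obtain ⟨ha, hc, hb⟩ := h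
    have ha' := congrArg (fun l : List ℕ => (l : Multiset ℕ)) ha
    have hb' := congrArg (fun l : List ℕ => (l : Multiset ℕ)) hb
    simp only [Multiset.sort_eq] at ha' hb'
    have hM : (t.1 : Multiset ℕ) + (t.2.2 : Multiset ℕ) = (t'.1 : Multiset ℕ) + (t'.2.2 : Multiset ℕ) := by
      rw [← tsub_add_cancel_of_le g1, ← tsub_add_cancel_of_le g1', ha', hb']
    have hs : t.2.2.length - 1 = t'.2.2.length - 1 := by
      rw [← g2, ← g2', hb']
    rw [← hM, ← hs] at hb'
    rw [← hM] at f2'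
    rw [← hs] at f3'
    have hB := hF2 _ _ f1 _ _ f2 f3 f2' f3' hb'
    rw [hB] at hM
    exact Subtype.ext (triple_ext ht ht' (add_right_cancel hM) hc hB)
end
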